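/- arXiv:0810.5728 — 2 statements merged into one kernel-verified Lean document; each statement's English description precedes it below -/
import Mathlib

section
/- Let M be a cleaned-up MDP with target sets F_1,…,F_k, F = ∪_i F_i, every state of F absorbing, and initial distribution α on V∖F. Then the achievable set U = {r ∈ ℝ^k_{≥0} : ∃ strategy σ with Pr^σ_α(◇F_i) ≥ r_i for all i} is a convex polytope (the projection onto the r-coordinates of the polyhedron given by the LP constraints together with Σ_{v∈F_i} y_v ≥ r_i, intersected with [0,1]^k), and U is downward closed: if r ∈ U and 0 ≤ r' ≤ r coordinatewise, then r' ∈ U. The same holds for the set U^⊙ of vectors achievable by memoryless strategies, and U = U^⊙. -/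
open scoped BigOperators
open MeasureTheory

/-- A finite-state Markov decision process: a finite set of states `V`, a finite
action alphabet `A`, a nonempty set of enabled actions at each state, and for each
state and enabled action a probability distribution on next states. -/
structure MDP (V A : Type) [Fintype V] [Fintype A] where
  enabled : V → Finset A
  enabled_nonempty : ∀ v, (enabled v).Nonempty
  p : V → A → V → ℝ
  p_nonneg : ∀ v a v', 0 ≤ p v a v'
  p_sum : ∀ v, ∀ a ∈ enabled v, ∑ v', p v a v' = 1

namespace MDP

variable {V A : Type} [Fintype V] [Fintype A]

/-- A (history-dependent, randomized) strategy: given the list of past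
(state, action) pairs (most recent first) and the current state, a probability
distribution on actions, supported on the enabled actions. -/
structure Strategy (M : MDP V A) where
  act : List (V × A) → V → A → ℝ
  act_nonneg : ∀ h v a, 0 ≤ act h v a
  act_support : ∀ h v a, a ∉ M.enabled v → act h v a = 0
  act_sum : ∀ h v, ∑ a, act h v a = 1

/-- A strategy is memoryless (stationary) if it depends only on the current state. -/
def Strategy.Memoryless {M : MDP V A} (σ : M.Strategy) : Prop :=
  ∀ h h' v, σ.act h v = σ.act h' v

/-- A strategy is pure (deterministic) if it always plays a single action with
probability 1. -/
def Strategy.Pure {M : MDP V A} (σ : M.Strategy) : Prop :=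
  ∀ h v, ∃ a, σ.act h v a = 1

/-- `α` is a probability distribution on `V`. -/
def IsDist (α : V → ℝ) : Prop :=
  (∀ v, 0 ≤ α v) ∧ ∑ v, α v = 1

/-- The point (Dirac) distribution at `u`. -/
def diracD [DecidableEq V] (u : V) : V → ℝ := fun v => if v = u then 1 else 0

/-- The `m`-th binary digit of `x`. -/
noncomputable def bit (m : ℕ) (x : ℝ) : ℝ :=
  if ⌊x * 2 ^ (m + 1)⌋ % 2 = 1 then 1 else 0

/-- Extracts from a single seed `x ∈ [0,1]` a sequence of independent uniform
`[0,1]` samples, by splitting the binary digits of `x`. -/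
noncomputable def unif (k : ℕ) (x : ℝ) : ℝ :=
  ∑' n : ℕ, bit (Nat.pair k n) x / 2 ^ (n + 1)

/-- Inverse-CDF sampling from a distribution `q` on a finite type, using the
uniform sample `u`. -/
noncomputable def sample {S : Type} [Fintype S] [Nonempty S] (q : S → ℝ) (u : ℝ) : S :=
  let e := Fintype.equivFin S
  if h : (Finset.univ.filter fun i => u < ∑ j ∈ Finset.Iic i, q (e.symm j)).Nonempty then
    e.symm ((Finset.univ.filter fun i => u < ∑ j ∈ Finset.Iic i, q (e.symm j)).min' h)
  else Classical.arbitrary S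

variable [Nonempty V] [Nonempty A]

/-- The random run of `M` under strategy `σ` from initial distribution `α`, driven by
the random seed `x`: at time `n` it returns the list of past (state, action) pairs
(most recent first) together with the current state and the action chosen there. -/
noncomputable def run (M : MDP V A) (σ : M.Strategy) (α : V → ℝ) (x : ℝ) :
    ℕ → List (V × A) × (V × A)
  | 0 =>
      let s := sample α (unif 0 x)
      ([], (s, sample (σ.act [] s) (unif 1 x)))
  | n + 1 =>
      let r := run M σ α x n
      let s' := sample (M.p r.2.1 r.2.2) (unif (2 * n + 2) x)
      (r.2 :: r.1, (s', sample (σ.act (r.2 :: r.1) s') (unif (2 * n + 3) x)))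

/-- The state at time `n` of the run driven by seed `x`. -/
noncomputable def stateAt (M : MDP V A) (σ : M.Strategy) (α : V → ℝ) (x : ℝ) (n : ℕ) : V :=
  (M.run σ α x n).2.1

/-- The probability, under strategy `σ` from initial distribution `α`, that the
infinite trajectory of states belongs to the event `E`. -/
noncomputable def PrEvent (M : MDP V A) (σ : M.Strategy) (α : V → ℝ) (E : Set (ℕ → V)) : ℝ :=
  (volume {x : ℝ | x ∈ Set.Icc (0 : ℝ) 1 ∧ M.stateAt σ α x ∈ E}).toReal

/-- The probability of eventually visiting the set `F` (the event `◇F`). -/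
noncomputable def PrReach (M : MDP V A) (σ : M.Strategy) (α : V → ℝ) (F : Set V) : ℝ :=
  M.PrEvent σ α {w | ∃ n, w n ∈ F}

/-- A state is absorbing if it has a single enabled action, which loops on it with
probability 1. -/
def Absorbing (M : MDP V A) (v : V) : Prop :=
  ∃ a, M.enabled v = {a} ∧ M.p v a v = 1

/-- One positive-probability step of the underlying graph of the MDP. -/
def Step (M : MDP V A) (v v' : V) : Prop :=
  ∃ a ∈ M.enabled v, 0 < M.p v a v'

/-- The MDP is cleaned-up w.r.t. `F`: from every state there is a path of
positive-probability transitions reaching `F`. -/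
def CleanedUp (M : MDP V A) (F : Set V) : Prop :=
  ∀ v, ∃ w ∈ F, Relation.ReflTransGen M.Step v w

end MDP

namespace MDP

variable {V A : Type} [Fintype V] [Fintype A]

/-- Feasibility for the multi-objective LP associated with `(M, α, F)`:
`y` are the variables `y_{(v,γ)}` (for `v ∉ F`), `yF` the variables `y_v` (for `v ∈ F`). -/
def LPFeasible [DecidableEq V] (M : MDP V A) (α : V → ℝ) (F : Finset V)
    (y : V → A → ℝ) (yF : V → ℝ) : Prop :=
  (∀ v ∉ F, (∑ a ∈ M.enabled v, y v a) -
      (∑ v' ∈ Fᶜ, ∑ a' ∈ M.enabled v', M.p v' a' v * y v' a') = α v) ∧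
  (∀ v ∈ F, yF v - (∑ v' ∈ Fᶜ, ∑ a' ∈ M.enabled v', M.p v' a' v * y v' a') = 0) ∧
  (∀ v ∈ F, 0 ≤ yF v) ∧
  (∀ v ∉ F, ∀ a ∈ M.enabled v, 0 ≤ y v a)

/-- The substochastic matrix `P^σ` on `V ∖ F` induced by a memoryless strategy `σ`. -/
noncomputable def Pmat [DecidableEq V] (M : MDP V A) (σ : M.Strategy) (F : Finset V) :
    Matrix {v : V // v ∉ F} {v : V // v ∉ F} ℝ :=
  Matrix.of fun v v' => ∑ a ∈ M.enabled v.1, σ.act [] v.1 a * M.p v.1 a v'.1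

end MDP

namespace MDP

variable {V A : Type} [Fintype V] [Fintype A] [Nonempty V] [Nonempty A]

/-- The achievable set `U` for the reachability objectives `◇F_1, …, ◇F_k`. -/
noncomputable def achSet (M : MDP V A) (α : V → ℝ) {k : ℕ} (Fi : Fin k → Finset V) :
    Set (Fin k → ℝ) :=
  {r | (∀ i, 0 ≤ r i) ∧ ∃ σ : M.Strategy, ∀ i, r i ≤ M.PrReach σ α (↑(Fi i) : Set V)}

/-- The set `U^⊙` of vectors achievable by (randomized) memoryless strategies. -/
noncomputable def achSetML (M : MDP V A) (α : V → ℝ) {k : ℕ} (Fi : Fin k → Finset V) :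
    Set (Fin k → ℝ) :=
  {r | (∀ i, 0 ≤ r i) ∧
    ∃ σ : M.Strategy, σ.Memoryless ∧ ∀ i, r i ≤ M.PrReach σ α (↑(Fi i) : Set V)}

end MDP

namespace MDP

open ProbabilityTheory Set

/-- The mass that a fair coin with values in `{0, 1}` gives to `s`. -/
noncomputable def coin (s : Set ℝ) : ENNReal :=
  2⁻¹ * s.indicator 1 0 + 2⁻¹ * s.indicator 1 1

lemma measurable_bit (m : ℕ) : Measurable (bit m) := by
  unfold bit
  refine Measurable.ite ?_ measurable_const measurable_const
  exact (Int.measurable_floor.comp (measurable_id.mul_const _))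
    (MeasurableSet.of_discrete (s := {z : ℤ | z % 2 = 1}))

lemma bit_succ (m : ℕ) (x : ℝ) : bit (m + 1) x = bit m (2 * x) := by
  unfold bit
  rw [show x * 2 ^ (m + 1 + 1) = 2 * x * 2 ^ (m + 1) by ring]

lemma bit_sub_one (m : ℕ) (x : ℝ) : bit m (x - 1) = bit m x := by
  have h : (x - 1) * 2 ^ (m + 1) = x * 2 ^ (m + 1) - ((2 ^ (m + 1) : ℤ) : ℝ) := by
    push_cast; ring
  have h2 : (⌊x * 2 ^ (m + 1)⌋ - 2 ^ (m + 1)) % 2 = ⌊x * 2 ^ (m + 1)⌋ % 2 := by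
    rw [pow_succ]; omega
  unfold bit
  rw [h, Int.floor_sub_intCast, h2]

lemma bit_zero_of_lt {x : ℝ} (h0 : 0 ≤ x) (h1 : x < 1 / 2) : bit 0 x = 0 := by
  have : ⌊x * 2 ^ (0 + 1)⌋ = 0 := by
    rw [Int.floor_eq_iff]; norm_num; constructor <;> linarith
  simp only [bit, this]
  norm_num

lemma bit_zero_of_le {x : ℝ} (h0 : 1 / 2 ≤ x) (h1 : x < 1) : bit 0 x = 1 := by
  have : ⌊x * 2 ^ (0 + 1)⌋ = 1 := by
    rw [Int.floor_eq_iff]; norm_num; constructor <;> linarith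
  simp only [bit, this]
  norm_num

lemma volume_bits (n : ℕ) (s : ℕ → Set ℝ) (hs : ∀ i, MeasurableSet (s i)) :
    volume (Ico (0 : ℝ) 1 ∩ {x | ∀ i < n, bit i x ∈ s i}) =
      ∏ i ∈ Finset.range n, coin (s i) := by
  induction n generalizing s with
  | zero => simp
  | succ n ih =>
    set A : Set ℝ := {x | ∀ i < n, bit i x ∈ s (i + 1)} with hA
    have hAm : MeasurableSet A := by
      have : A = ⋂ i, ⋂ (_ : i < n), bit i ⁻¹' s (i + 1) := by ext; simp [hA]
      rw [this]
      exact MeasurableSet.iInter fun i => MeasurableSet.iInter fun _ =>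
        measurable_bit i (hs _)
    have hper : ∀ x, x - 1 ∈ A ↔ x ∈ A := by intro x; simp [hA, bit_sub_one]
    set L : Set ℝ := (fun x => 2 * x) ⁻¹' (Ico 0 1 ∩ A)
    set R : Set ℝ := (fun x => 2 * x) ⁻¹' ((fun x => x - 1) ⁻¹' (Ico 0 1 ∩ A))
    have hI : MeasurableSet (Ico (0 : ℝ) 1 ∩ A) := measurableSet_Ico.inter hAm
    have hL : volume L = 2⁻¹ * volume (Ico (0 : ℝ) 1 ∩ A) := by
      rw [Real.volume_preimage_mul_left two_ne_zero, abs_of_pos (by norm_num),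
        ENNReal.ofReal_inv_of_pos (by norm_num)]
      simp
    have hR : volume R = 2⁻¹ * volume (Ico (0 : ℝ) 1 ∩ A) := by
      rw [Real.volume_preimage_mul_left two_ne_zero, abs_of_pos (by norm_num),
        ENNReal.ofReal_inv_of_pos (by norm_num)]
      simp only [sub_eq_add_neg, measure_preimage_add_right]
      simp
    have hRm : MeasurableSet R :=
      (measurable_const.mul measurable_id) ((measurable_id.sub_const 1) hI)
    have hsplit : Ico (0 : ℝ) 1 ∩ {x | ∀ i < n + 1, bit i x ∈ s i} =
        (L ∩ {_x | (0 : ℝ) ∈ s 0}) ∪ (R ∩ {_x | (1 : ℝ) ∈ s 0}) := by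
      ext x
      have h1 : (∀ i < n + 1, bit i x ∈ s i) ↔ bit 0 x ∈ s 0 ∧ 2 * x ∈ A := by
        rw [Nat.forall_lt_succ_left]
        simp [hA, bit_succ]
      simp only [mem_inter_iff, mem_ofPred_eq, h1, mem_union, L, R, mem_preimage, mem_Ico, hper]
      constructor
      · rintro ⟨⟨h0, h2⟩, hb, hx⟩
        rcases lt_or_ge x (1 / 2) with h | h
        · rw [bit_zero_of_lt h0 h] at hb
          exact Or.inl ⟨⟨⟨by linarith, by linarith⟩, hx⟩, hb⟩
        · rw [bit_zero_of_le h h2] at hb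
          exact Or.inr ⟨⟨⟨by linarith, by linarith⟩, hx⟩, hb⟩
      · rintro (⟨⟨⟨h0, h2⟩, hx⟩, hb⟩ | ⟨⟨⟨h0, h2⟩, hx⟩, hb⟩)
        · refine ⟨⟨by linarith, by linarith⟩, ?_, hx⟩
          rwa [bit_zero_of_lt (by linarith) (by linarith)]
        · refine ⟨⟨by linarith, by linarith⟩, ?_, hx⟩
          rwa [bit_zero_of_le (by linarith) (by linarith)]
    have hdisj : Disjoint (L ∩ {_x | (0 : ℝ) ∈ s 0}) (R ∩ {_x | (1 : ℝ) ∈ s 0}) := by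
      rw [Set.disjoint_left]
      rintro x ⟨⟨⟨h0, h1⟩, -⟩, -⟩ ⟨⟨⟨h2, h3⟩, -⟩, -⟩
      simp only at h1 h2
      linarith
    rw [hsplit, measure_union hdisj (hRm.inter (MeasurableSet.const _)),
      Finset.prod_range_succ', ← ih (fun i => s (i + 1)) (fun i => hs _), mul_comm, coin, add_mul]
    congr 1
    · by_cases h : (0 : ℝ) ∈ s 0 <;> simp [h, hL, hA]
    · by_cases h : (1 : ℝ) ∈ s 0 <;> simp [h, hR, hA]

/-- Lebesgue measure on `[0, 1]`, the law of the seed. -/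
noncomputable def seed : Measure ℝ := volume.restrict (Icc 0 1)

lemma seed_eq : seed = volume.restrict (Ico (0 : ℝ) 1) :=
  (Measure.restrict_congr_set Ico_ae_eq_Icc).symm

instance : IsProbabilityMeasure seed := ⟨by simp [seed]⟩

lemma coin_univ : coin univ = 1 := by
  simp [coin, ENNReal.inv_two_add_inv_two]

lemma seed_bits (S : Finset ℕ) (s : ℕ → Set ℝ) (hs : ∀ i ∈ S, MeasurableSet (s i)) :
    seed (⋂ i ∈ S, bit i ⁻¹' s i) = ∏ i ∈ S, coin (s i) := by
  classical
  set t : ℕ → Set ℝ := fun i => if i ∈ S then s i else univ with ht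
  have htm : ∀ i, MeasurableSet (t i) := by
    intro i
    by_cases h : i ∈ S
    · simp [ht, h, hs i h]
    · simp [ht, h]
  obtain ⟨n, hn⟩ := S.exists_nat_subset_range
  have h1 : (⋂ i ∈ S, bit i ⁻¹' s i) = {x | ∀ i < n, bit i x ∈ t i} := by
    ext x
    simp only [mem_iInter, mem_preimage, mem_ofPred_eq, ht]
    constructor
    · intro h i _
      by_cases hi : i ∈ S <;> simp [hi, h]
    · intro h i hi
      simpa [hi] using h i (Finset.mem_range.1 (hn hi))
  have h2 : MeasurableSet (⋂ i ∈ S, bit i ⁻¹' s i) :=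
    S.measurableSet_biInter fun i hi => measurable_bit i (hs i hi)
  rw [seed_eq, Measure.restrict_apply h2, inter_comm, h1, volume_bits n t htm,
    ← Finset.prod_subset hn]
  · exact Finset.prod_congr rfl fun i hi => by simp [ht, hi]
  · intro i _ hi
    simp [ht, hi, coin_univ]

lemma seed_bit (i : ℕ) {s : Set ℝ} (hs : MeasurableSet s) : seed (bit i ⁻¹' s) = coin s := by
  simpa using seed_bits {i} (fun _ => s) (by simpa using hs)

lemma iIndepFun_bit : iIndepFun bit seed := by
  rw [iIndepFun_iff_measure_inter_preimage_eq_mul]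
  intro S s hs
  rw [seed_bits S s hs]
  exact Finset.prod_congr rfl fun i hi => (seed_bit i (hs i hi)).symm

lemma map_bit (i : ℕ) : seed.map (bit i) = seed.map (bit 0) := by
  ext s hs
  rw [Measure.map_apply (measurable_bit i) hs, Measure.map_apply (measurable_bit 0) hs,
    seed_bit i hs, seed_bit 0 hs]

lemma bit_eq_digits {x : ℝ} (hx : 0 ≤ x) (i : ℕ) : bit i x = (Real.digits x 2 i : ℝ) := by
  have h : ⌊x * 2 ^ (i + 1)⌋ = (⌊x * 2 ^ (i + 1)⌋₊ : ℤ) :=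
    (Int.natCast_floor_eq_floor (by positivity)).symm
  unfold bit Real.digits
  rw [h]
  simp only [Fin.val_ofNat, Nat.cast_ofNat]
  rcases Nat.mod_two_eq_zero_or_one ⌊x * 2 ^ (i + 1)⌋₊ with h' | h' <;> rw [h'] <;> norm_num <;>
    omega

lemma tsum_bit {x : ℝ} (hx : x ∈ Ico (0 : ℝ) 1) : ∑' n, bit n x / 2 ^ (n + 1) = x := by
  have := (Real.hasSum_ofDigitsTerm_digits x (b := 2) (by norm_num) hx).tsum_eq
  refine Eq.trans (tsum_congr fun n => ?_) this
  rw [bit_eq_digits hx.1, Real.ofDigitsTerm, div_eq_mul_inv]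
  norm_num

/-- The value of a binary expansion. -/
noncomputable def binVal (d : ℕ → ℝ) : ℝ := ∑' n, d n / 2 ^ (n + 1)

lemma measurable_binVal : Measurable binVal :=
  Measurable.tsum fun n => (measurable_pi_apply n).div_const _

lemma map_unif (k : ℕ) : seed.map (unif k) = seed := by
  have hm : ∀ g : ℕ → ℕ, Measurable fun (x : ℝ) n => bit (g n) x :=
    fun g => measurable_pi_iff.2 fun n => measurable_bit _
  have h1 : seed.map (fun x n => bit (Nat.pair k n) x) = seed.map (fun x n => bit n x) := by
    have hg : Function.Injective (fun n => Nat.pair k n) := fun a b h => by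
      simpa using h
    have hi : iIndepFun (fun n => bit (Nat.pair k n)) seed := iIndepFun_bit.precomp hg
    rw [hi.map_fun_eq_infinitePi_map (fun n => measurable_bit _),
      iIndepFun_bit.map_fun_eq_infinitePi_map measurable_bit]
    congr 1
    ext1 n
    rw [map_bit, map_bit n]
  have h2 : unif k = binVal ∘ fun x n => bit (Nat.pair k n) x := rfl
  rw [h2, ← Measure.map_map measurable_binVal (hm _), h1,
    Measure.map_map measurable_binVal (hm _)]
  have h3 : (binVal ∘ fun (x : ℝ) n => bit n x) =ᵐ[seed] id := by
    rw [seed_eq]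
    filter_upwards [ae_restrict_mem measurableSet_Ico] with x hx
    exact tsum_bit hx
  rw [Measure.map_congr h3, Measure.map_id]

/-- The σ-algebra generated by the uniform samples with index below `k`. -/
noncomputable abbrev past (k : ℕ) : MeasurableSpace ℝ :=
  ⨆ i ∈ {i : ℕ | i.unpair.1 < k}, MeasurableSpace.comap (bit i) inferInstance

lemma past_mono {k l : ℕ} (h : k ≤ l) : past k ≤ past l :=
  biSup_mono fun _ hi => lt_of_lt_of_le hi h

lemma past_le (k : ℕ) : past k ≤ (inferInstance : MeasurableSpace ℝ) :=
  iSup₂_le fun i _ => (measurable_bit i).comap_le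

lemma measurable_binVal_comp {Ω : Type*} [MeasurableSpace Ω] {X : ℕ → Ω → ℝ}
    (h : ∀ n, Measurable (X n)) : Measurable fun ω => binVal fun n => X n ω :=
  measurable_binVal.comp (measurable_pi_iff.2 h)

lemma measurable_unif_iSup_bit {k : ℕ} {S : Set ℕ} (hS : ∀ n, Nat.pair k n ∈ S) :
    @Measurable ℝ ℝ (⨆ i ∈ S, MeasurableSpace.comap (bit i) Real.measurableSpace)
      Real.measurableSpace (unif k) :=
  @measurable_binVal_comp ℝ (⨆ i ∈ S, MeasurableSpace.comap (bit i) Real.measurableSpace)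
    (fun n => bit (Nat.pair k n)) fun n =>
      Measurable.mono (comap_measurable (bit (Nat.pair k n)))
        (le_iSup₂_of_le _ (hS n) le_rfl) le_rfl

lemma measurable_unif (k : ℕ) : Measurable (unif k) :=
  measurable_binVal_comp fun n => measurable_bit (Nat.pair k n)

lemma measurable_unif_past {j k : ℕ} (h : j < k) :
    @Measurable ℝ ℝ (past k) Real.measurableSpace (unif j) :=
  measurable_unif_iSup_bit (by simpa using h)

lemma indep_past_unif (k : ℕ) {E : Set ℝ} (hE : MeasurableSet[past k] E) {B : Set ℝ}
    (hB : MeasurableSet B) : seed (E ∩ unif k ⁻¹' B) = seed E * seed B := by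
  have h := indep_iSup_of_disjoint (fun i => (measurable_bit i).comap_le) iIndepFun_bit.iIndep
    (S := {i : ℕ | i.unpair.1 < k}) (T := {i : ℕ | i.unpair.1 = k})
    (by rw [Set.disjoint_left]; intro i h1 h2; simp at h1 h2; omega)
  rw [(Indep_iff _ _ _).1 h E _ hE (measurable_unif_iSup_bit (by simp) hB),
    ← Measure.map_apply (measurable_unif k) hB, map_unif]

end MDP

namespace MDP

open ProbabilityTheory Set

section Sample

variable {S : Type} [Fintype S] [Nonempty S]

lemma measurableSet_sample (q : S → ℝ) (s : S) : MeasurableSet (sample q ⁻¹' {s}) := by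
  let e := Fintype.equivFin S
  let T : ℝ → Finset (Fin (Fintype.card S)) :=
    fun u => Finset.univ.filter fun i => u < ∑ j ∈ Finset.Iic i, q (e.symm j)
  let g : Finset (Fin (Fintype.card S)) → S :=
    fun t => if h : t.Nonempty then e.symm (t.min' h) else Classical.arbitrary S
  have hg : sample q = g ∘ T := rfl
  have hT : ∀ t, MeasurableSet (T ⁻¹' {t}) := by
    intro t
    have : T ⁻¹' {t} = ⋂ i, {u | u < ∑ j ∈ Finset.Iic i, q (e.symm j) ↔ i ∈ t} := by
      ext u
      simp [T, Finset.ext_iff]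
    rw [this]
    refine MeasurableSet.iInter fun i => ?_
    by_cases h : i ∈ t
    · simp only [h, iff_true]
      exact measurableSet_Iio
    · simp only [h, iff_false, not_lt]
      exact measurableSet_Ici
  rw [hg, preimage_comp, ← biUnion_preimage_singleton]
  exact MeasurableSet.biUnion (Set.to_countable _) fun t _ => hT t

lemma seed_sample {q : S → ℝ} (h0 : ∀ s, 0 ≤ q s) (h1 : ∑ s, q s = 1) (s : S) :
    seed (sample q ⁻¹' {s}) = ENNReal.ofReal (q s) := by
  let e := Fintype.equivFin S
  let C : Fin (Fintype.card S) → ℝ := fun i => ∑ j ∈ Finset.Iic i, q (e.symm j)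
  let D : Fin (Fintype.card S) → ℝ := fun i => ∑ j ∈ Finset.Iio i, q (e.symm j)
  have hCD : ∀ i, C i = q (e.symm i) + D i := by
    intro i
    have : Finset.Iic i = insert i (Finset.Iio i) := by ext; simp [le_iff_eq_or_lt]
    simp only [C, D, this]
    rw [Finset.sum_insert (by simp)]
  have hD0 : ∀ i, 0 ≤ D i := fun i => Finset.sum_nonneg fun _ _ => h0 _
  have htot : ∑ j, q (e.symm j) = 1 := by rw [← h1]; exact Equiv.sum_comp e.symm q
  have hC1 : ∀ i, C i ≤ 1 := fun i => by
    rw [← htot]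
    exact Finset.sum_le_sum_of_subset_of_nonneg (Finset.subset_univ _) fun _ _ _ => h0 _
  have hne : ∀ u < 1, (Finset.univ.filter fun i => u < C i).Nonempty := by
    intro u hu
    have hpos : 0 < Fintype.card S := Fintype.card_pos
    refine ⟨⟨Fintype.card S - 1, by omega⟩, ?_⟩
    have : Finset.Iic (⟨Fintype.card S - 1, by omega⟩ : Fin (Fintype.card S)) = Finset.univ := by
      ext j
      simp only [Finset.mem_Iic, Finset.mem_univ, iff_true, Fin.le_def]
      omega
    simp [C, this, htot, hu]
  have hset : sample q ⁻¹' {s} ∩ Ico 0 1 = Ico (D (e s)) (C (e s)) := by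
    ext u
    simp only [mem_inter_iff, mem_preimage, mem_singleton_iff, mem_Ico]
    have key : u < 1 → (sample q u = s ↔
        u < C (e s) ∧ ∀ j, u < C j → e s ≤ j) := by
      intro hu
      have : sample q u = e.symm ((Finset.univ.filter fun i => u < C i).min' (hne u hu)) :=
        dif_pos (hne u hu)
      rw [this, Equiv.symm_apply_eq, Finset.min'_eq_iff]
      simp
    constructor
    · rintro ⟨hs, hu0, hu1⟩
      obtain ⟨h2, h3⟩ := (key hu1).1 hs
      refine ⟨?_, h2⟩
      rcases Nat.eq_zero_or_pos (e s).val with h | h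
      · have : Finset.Iio (e s) = ∅ := by
          ext j; simp only [Finset.mem_Iio, Fin.lt_def]; simp; omega
        simpa [D, this] using hu0
      · by_contra hlt
        push Not at hlt
        have : Finset.Iio (e s) = Finset.Iic (⟨(e s).val - 1, by omega⟩ : Fin _) := by
          ext j; simp only [Finset.mem_Iio, Finset.mem_Iic, Fin.lt_def, Fin.le_def]; omega
        have h4 := h3 ⟨(e s).val - 1, by omega⟩ (by simpa [D, C, this] using hlt)
        rw [Fin.le_def] at h4
        simp at h4
        omega
    · rintro ⟨hd, hc⟩
      have hu1 : u < 1 := hc.trans_le (hC1 _)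
      refine ⟨(key hu1).2 ⟨hc, fun j hj => ?_⟩, (hD0 _).trans hd, hu1⟩
      by_contra hlt
      push Not at hlt
      have : C j ≤ D (e s) := Finset.sum_le_sum_of_subset_of_nonneg
        (fun i hi => Finset.mem_Iio.2 ((Finset.mem_Iic.1 hi).trans_lt hlt)) fun _ _ _ => h0 _
      linarith
  rw [seed_eq, Measure.restrict_apply (measurableSet_sample q s), hset, Real.volume_Ico, hCD]
  simp

lemma indep_past_sample {k : ℕ} {E : Set ℝ} (hE : MeasurableSet[past k] E) {q : S → ℝ}
    (h0 : ∀ s, 0 ≤ q s) (h1 : ∑ s, q s = 1) (s : S) :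
    seed.real (E ∩ {x | sample q (unif k x) = s}) = seed.real E * q s := by
  have : {x | sample q (unif k x) = s} = unif k ⁻¹' (sample q ⁻¹' {s}) := rfl
  rw [this, measureReal_def, indep_past_unif k hE (measurableSet_sample q s), seed_sample h0 h1,
    ENNReal.toReal_mul, ENNReal.toReal_ofReal (h0 s), measureReal_def]

lemma measurableSet_past_sample {j k : ℕ} (h : j < k) (q : S → ℝ) (s : S) :
    MeasurableSet[past k] {x | sample q (unif j x) = s} :=
  measurable_unif_past h (measurableSet_sample q s)

end Sample

lemma Absorbing.p_eq_zero {V A : Type} [Fintype V] [Fintype A] {M : MDP V A} {v : V}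
    (hv : M.Absorbing v) {a : A}
    (ha : a ∈ M.enabled v) {w : V} (hw : w ≠ v) : M.p v a w = 0 := by
  classical
  obtain ⟨b, hb, hb1⟩ := hv
  obtain rfl : a = b := by simpa [hb] using ha
  have h := M.p_sum v a ha
  rw [← Finset.add_sum_erase _ _ (Finset.mem_univ v), hb1, add_eq_left,
    Finset.sum_eq_zero_iff_of_nonneg fun _ _ => M.p_nonneg _ _ _] at h
  exact h w (by simp [hw])

variable {V A : Type} [Fintype V] [Fintype A] [Nonempty V] [Nonempty A]
  (M : MDP V A) (σ : M.Strategy) (α : V → ℝ)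

lemma measurableSet_fiber {X : Type*} [Countable X] {m : MeasurableSpace ℝ} {f : ℝ → X}
    (h : ∀ c, MeasurableSet[m] {x | f x = c}) (T : Set X) : MeasurableSet[m] {x | f x ∈ T} := by
  have : {x | f x ∈ T} = ⋃ c ∈ T, {x | f x = c} := by ext; simp
  rw [this]
  exact MeasurableSet.biUnion (Set.to_countable _) fun c _ => h c

lemma measurableSet_run_of_state {n : ℕ}
    (h : ∀ l v, MeasurableSet[past (2 * n + 1)]
      {x | (M.run σ α x n).1 = l ∧ (M.run σ α x n).2.1 = v})
    (ha : ∀ x, (M.run σ α x n).2.2 =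
      sample (σ.act (M.run σ α x n).1 (M.run σ α x n).2.1) (unif (2 * n + 1) x))
    (c : List (V × A) × (V × A)) : MeasurableSet[past (2 * n + 2)] {x | M.run σ α x n = c} := by
  have : {x | M.run σ α x n = c} =
      {x | (M.run σ α x n).1 = c.1 ∧ (M.run σ α x n).2.1 = c.2.1} ∩
        {x | sample (σ.act c.1 c.2.1) (unif (2 * n + 1) x) = c.2.2} := by
    ext x
    simp only [mem_ofPred_eq, mem_inter_iff, Prod.ext_iff, ha]
    constructor
    · rintro ⟨h1, h2, h3⟩
      rw [h1, h2] at h3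
      exact ⟨⟨h1, h2⟩, h3⟩
    · rintro ⟨⟨h1, h2⟩, h3⟩
      rw [h1, h2]
      exact ⟨rfl, rfl, h3⟩
  rw [this]
  exact MeasurableSet.inter (past_mono (by omega) _ (h c.1 c.2.1))
    (measurableSet_past_sample (by omega) _ _)

lemma run_action (x : ℝ) (n : ℕ) : (M.run σ α x n).2.2 =
    sample (σ.act (M.run σ α x n).1 (M.run σ α x n).2.1) (unif (2 * n + 1) x) := by
  cases n <;> rfl

lemma measurableSet_history_state (n : ℕ) (l : List (V × A)) (v : V) :
    MeasurableSet[past (2 * n + 1)]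
      {x | (M.run σ α x n).1 = l ∧ (M.run σ α x n).2.1 = v} := by
  induction n generalizing l v with
  | zero =>
    have : {x | (M.run σ α x 0).1 = l ∧ (M.run σ α x 0).2.1 = v} =
        {_x | [] = l} ∩ {x | sample α (unif 0 x) = v} := rfl
    rw [this]
    exact (MeasurableSet.const _).inter (measurableSet_past_sample (by omega) _ _)
  | succ n ih =>
    have hr := measurableSet_run_of_state M σ α ih (fun x => run_action M σ α x n)
    rcases l with _ | ⟨r, l⟩
    · have : {x | (M.run σ α x (n + 1)).1 = [] ∧ (M.run σ α x (n + 1)).2.1 = v} = ∅ := by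
        ext x; simp [run]
      rw [this]
      exact @MeasurableSet.empty _ (past _)
    · have : {x | (M.run σ α x (n + 1)).1 = r :: l ∧ (M.run σ α x (n + 1)).2.1 = v} =
          {x | M.run σ α x n = (l, r)} ∩ {x | sample (M.p r.1 r.2) (unif (2 * n + 2) x) = v} := by
        ext x
        simp only [run, mem_ofPred_eq, mem_inter_iff, List.cons.injEq]
        constructor
        · rintro ⟨⟨rfl, rfl⟩, h⟩
          exact ⟨rfl, h⟩
        · rintro ⟨h, h'⟩
          rw [h]
          exact ⟨⟨rfl, rfl⟩, h'⟩
      rw [this]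
      exact MeasurableSet.inter (past_mono (by omega) _ (hr _))
        (measurableSet_past_sample (by omega) _ _)

lemma measurableSet_run (n : ℕ) (T : Set (List (V × A) × (V × A))) :
    MeasurableSet[past (2 * n + 2)] {x | M.run σ α x n ∈ T} :=
  measurableSet_fiber (measurableSet_run_of_state M σ α (measurableSet_history_state M σ α n)
    fun x => run_action M σ α x n) T

lemma measurableSet_stateAt_past (n : ℕ) (v : V) :
    MeasurableSet[past (2 * n + 1)] {x | M.stateAt σ α x n = v} :=
  measurableSet_fiber (f := fun x => ((M.run σ α x n).1, (M.run σ α x n).2.1))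
    (fun c => by
      simpa only [Prod.ext_iff] using measurableSet_history_state M σ α n c.1 c.2) {c | c.2 = v}

lemma measurableSet_stateAt (n : ℕ) (G : Set V) : MeasurableSet {x | M.stateAt σ α x n ∈ G} :=
  measurableSet_fiber (fun v => past_le _ _ (measurableSet_stateAt_past M σ α n v)) G

/-- The probability of being in state `v` at time `n`. -/
noncomputable def stateProb (n : ℕ) (v : V) : ℝ := seed.real {x | M.stateAt σ α x n = v}

/-- The probability of being in state `v` and playing `a` at time `n`. -/
noncomputable def occ (n : ℕ) (v : V) (a : A) : ℝ := seed.real {x | (M.run σ α x n).2 = (v, a)}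

lemma measurableSet_occ (n : ℕ) (v : V) (a : A) :
    MeasurableSet[past (2 * n + 2)] {x | (M.run σ α x n).2 = (v, a)} :=
  measurableSet_run M σ α n {c | c.2 = (v, a)}

lemma measureReal_inter_fiber {X : Type*} [Fintype X] {f : ℝ → X}
    (h : ∀ c, MeasurableSet {x | f x = c}) (E : Set ℝ) :
    seed.real E = ∑ c, seed.real (E ∩ {x | f x = c}) := by
  have h1 := measure_biUnion_finset (μ := seed.restrict E) (s := Finset.univ)
    (f := fun c => {x | f x = c})
    (fun a _ b _ hab => by
      rw [Function.onFun, Set.disjoint_left]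
      rintro x rfl hx
      exact hab hx) (fun c _ => h c)
  have h2 : (⋃ c ∈ Finset.univ, {x | f x = c}) = univ := by ext; simp
  rw [h2, Measure.restrict_apply_univ] at h1
  rw [measureReal_def, h1, ENNReal.toReal_sum (fun _ _ => measure_ne_top _ _)]
  refine Finset.sum_congr rfl fun c _ => ?_
  rw [Measure.restrict_apply (h c), inter_comm, measureReal_def]

lemma sum_occ (n : ℕ) (v : V) : ∑ a, M.occ σ α n v a = M.stateProb σ α n v := by
  rw [stateProb, measureReal_inter_fiber (f := fun x => (M.run σ α x n).2.2)
    fun a => past_le _ _ (measurableSet_run M σ α n {c | c.2.2 = a})]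
  refine Finset.sum_congr rfl fun a _ => ?_
  rw [occ]
  congr 1
  ext x
  simp [stateAt, Prod.ext_iff]

lemma stateProb_zero {α : V → ℝ} (hα : IsDist α) (v : V) : M.stateProb σ α 0 v = α v := by
  have := indep_past_sample (k := 0) (E := univ) MeasurableSet.univ hα.1 hα.2 v
  rw [univ_inter, probReal_univ, one_mul] at this
  exact this

lemma occ_nonneg (n : ℕ) (v : V) (a : A) : 0 ≤ M.occ σ α n v a := measureReal_nonneg

lemma occ_of_notMem (n : ℕ) {v : V} {a : A} (ha : a ∉ M.enabled v) : M.occ σ α n v a = 0 := by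
  have : {x | (M.run σ α x n).2 = (v, a)} ⊆ ⋃ l,
      ({x | (M.run σ α x n).1 = l ∧ (M.run σ α x n).2.1 = v} ∩
        {x | sample (σ.act l v) (unif (2 * n + 1) x) = a}) := by
    intro x hx
    have h := run_action M σ α x n
    rw [mem_ofPred_eq] at hx
    rw [hx] at h
    exact mem_iUnion.2 ⟨(M.run σ α x n).1, ⟨rfl, by rw [hx]⟩, h.symm⟩
  rw [occ, measureReal_eq_zero_iff]
  refine measure_mono_null this (measure_iUnion_null fun l => ?_)
  have := indep_past_sample (measurableSet_history_state M σ α n l v) (σ.act_nonneg l v)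
    (σ.act_sum l v) a
  rw [σ.act_support l v a ha, mul_zero, measureReal_eq_zero_iff] at this
  exact this

lemma occ_memoryless (hσ : σ.Memoryless) (n : ℕ) (v : V) (a : A) :
    M.occ σ α n v a = M.stateProb σ α n v * σ.act [] v a := by
  rw [stateProb, ← indep_past_sample (measurableSet_stateAt_past M σ α n v) (σ.act_nonneg [] v)
    (σ.act_sum [] v) a, occ]
  congr 1
  ext x
  simp only [mem_ofPred_eq, mem_inter_iff, stateAt, Prod.ext_iff, run_action]
  refine and_congr_right fun h => ?_
  rw [h, hσ _ [] v]

lemma occ_inter_stateAt (n : ℕ) (v : V) (a : A) (w : V) :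
    seed.real ({x | (M.run σ α x n).2 = (v, a)} ∩ {x | M.stateAt σ α x (n + 1) = w}) =
      M.occ σ α n v a * M.p v a w := by
  by_cases ha : a ∈ M.enabled v
  · rw [occ, ← indep_past_sample (measurableSet_occ M σ α n v a) (M.p_nonneg v a)
      (M.p_sum v a ha) w]
    congr 1
    ext x
    simp only [mem_ofPred_eq, mem_inter_iff, stateAt, run]
    refine and_congr_right fun h => ?_
    rw [h]
  · have h := occ_of_notMem M σ α n ha
    rw [h, zero_mul]
    exact le_antisymm ((measureReal_mono inter_subset_left).trans_eq h) measureReal_nonneg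

lemma stateProb_succ (n : ℕ) (w : V) : M.stateProb σ α (n + 1) w =
    ∑ v, ∑ a ∈ M.enabled v, M.p v a w * M.occ σ α n v a := by
  rw [stateProb, measureReal_inter_fiber (f := fun x => (M.run σ α x n).2)
    fun c => past_le _ _ (measurableSet_occ M σ α n c.1 c.2), Fintype.sum_prod_type]
  refine Finset.sum_congr rfl fun v _ => ?_
  rw [← Finset.sum_subset (Finset.subset_univ (M.enabled v))]
  · refine Finset.sum_congr rfl fun a _ => ?_
    rw [inter_comm, occ_inter_stateAt, mul_comm]
  · intro a _ ha
    rw [inter_comm, occ_inter_stateAt, occ_of_notMem M σ α n ha, zero_mul]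

lemma seed_stateAt (n : ℕ) (G : Finset V) :
    seed.real {x | M.stateAt σ α x n ∈ G} = ∑ v ∈ G, M.stateProb σ α n v := by
  classical
  rw [measureReal_inter_fiber (f := fun x => M.stateAt σ α x n)
    fun v => measurableSet_stateAt M σ α n {v}, ← Finset.sum_subset (Finset.subset_univ G)]
  · refine Finset.sum_congr rfl fun v hv => ?_
    rw [stateProb]
    congr 1
    ext x
    simp only [mem_inter_iff, mem_ofPred_eq, and_iff_right_iff_imp]
    rintro rfl
    exact hv
  · intro v _ hv
    have : {x | M.stateAt σ α x n ∈ G} ∩ {x | M.stateAt σ α x n = v} = ∅ := by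
      ext x
      simp only [mem_inter_iff, mem_ofPred_eq, mem_empty_iff_false, iff_false, not_and]
      rintro h rfl
      exact hv h
    rw [this, measureReal_empty]

lemma prReach_eq (G : Set V) :
    M.PrReach σ α G = seed.real {x | ∃ n, M.stateAt σ α x n ∈ G} := by
  have hm : MeasurableSet {x | ∃ n, M.stateAt σ α x n ∈ G} := by
    have : {x | ∃ n, M.stateAt σ α x n ∈ G} = ⋃ n, {x | M.stateAt σ α x n ∈ G} := by ext; simp
    rw [this]
    exact MeasurableSet.iUnion fun n => measurableSet_stateAt M σ α n G
  rw [PrReach, PrEvent, measureReal_def, seed, Measure.restrict_apply hm, inter_comm]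
  rfl

lemma prReach_le_one (G : Set V) : M.PrReach σ α G ≤ 1 := by
  rw [prReach_eq]
  exact measureReal_le_one

lemma sum_stateProb_le_prReach (n : ℕ) (G : Finset V) :
    ∑ v ∈ G, M.stateProb σ α n v ≤ M.PrReach σ α (G : Set V) := by
  rw [prReach_eq, ← seed_stateAt]
  exact measureReal_mono fun x hx => ⟨n, hx⟩

lemma ae_absorbing {v : V} (hv : M.Absorbing v) (n : ℕ) :
    ∀ᵐ x ∂seed, M.stateAt σ α x n = v → M.stateAt σ α x (n + 1) = v := by
  have h : ∀ a w, w ≠ v → ∀ᵐ x ∂seed,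
      ¬ ((M.run σ α x n).2 = (v, a) ∧ M.stateAt σ α x (n + 1) = w) := by
    intro a w hw
    rw [ae_iff]
    simp only [not_not]
    have h := occ_inter_stateAt M σ α n v a w
    have h0 : M.occ σ α n v a * M.p v a w = 0 := by
      by_cases ha : a ∈ M.enabled v
      · rw [hv.p_eq_zero ha hw, mul_zero]
      · rw [occ_of_notMem M σ α n ha, zero_mul]
    rwa [h0, measureReal_eq_zero_iff] at h
  have h' : ∀ᵐ x ∂seed, ∀ a w, w ≠ v →
      ¬ ((M.run σ α x n).2 = (v, a) ∧ M.stateAt σ α x (n + 1) = w) := by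
    simp only [ae_all_iff]
    exact h
  filter_upwards [h'] with x hx hv
  by_contra hne
  exact hx (M.run σ α x n).2.2 _ hne ⟨Prod.ext hv rfl, rfl⟩

lemma tendsto_sum_stateProb {G : Finset V} (hG : ∀ v ∈ G, M.Absorbing v) :
    Filter.Tendsto (fun n => ∑ v ∈ G, M.stateProb σ α n v) Filter.atTop
      (nhds (M.PrReach σ α (G : Set V))) := by
  have habs : ∀ᵐ x ∂seed, ∀ n, M.stateAt σ α x n ∈ G → M.stateAt σ α x (n + 1) ∈ G := by
    rw [ae_all_iff]
    intro n
    have : ∀ᵐ x ∂seed, ∀ v : G, M.stateAt σ α x n = v → M.stateAt σ α x (n + 1) = v :=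
      ae_all_iff.2 fun v => ae_absorbing M σ α (hG v v.2) n
    filter_upwards [this] with x hx h
    rw [hx ⟨_, h⟩ rfl]
    exact h
  have hmono : Monotone fun N => {x | ∃ n ≤ N, M.stateAt σ α x n ∈ G} :=
    fun N N' h x ⟨n, hn, hx⟩ => ⟨n, hn.trans h, hx⟩
  have hU : ⋃ N, {x | ∃ n ≤ N, M.stateAt σ α x n ∈ G} =
      {x | ∃ n, M.stateAt σ α x n ∈ (G : Set V)} := by
    ext x
    simp only [mem_iUnion, mem_ofPred_eq, Finset.mem_coe]
    exact ⟨fun ⟨_, n, _, h⟩ => ⟨n, h⟩, fun ⟨n, h⟩ => ⟨n, n, le_rfl, h⟩⟩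
  have ht := (ENNReal.continuousAt_toReal (measure_ne_top seed _)).tendsto.comp
    (tendsto_measure_iUnion_atTop (μ := seed) hmono)
  rw [hU] at ht
  rw [prReach_eq]
  refine ht.congr fun N => ?_
  rw [← seed_stateAt]
  refine congrArg ENNReal.toReal (measure_congr ?_)
  filter_upwards [habs] with x hx
  refine propext ⟨?_, fun h => ⟨N, le_rfl, h⟩⟩
  rintro ⟨n, hn, h⟩
  exact Nat.le_induction h (fun m _ ih => hx m ih) N hn

lemma stateProb_nonneg (n : ℕ) (v : V) : 0 ≤ M.stateProb σ α n v := measureReal_nonneg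

lemma sum_stateProb (n : ℕ) : ∑ v, M.stateProb σ α n v = 1 := by
  rw [← seed_stateAt]
  simp

lemma sum_enabled_occ (n : ℕ) (v : V) :
    ∑ a ∈ M.enabled v, M.occ σ α n v a = M.stateProb σ α n v := by
  rw [← sum_occ]
  exact Finset.sum_subset (Finset.subset_univ _) fun a _ ha => occ_of_notMem M σ α n ha

end MDP

/-- A finitely generated cone is closed. -/
lemma LinearMap.isClosed_image_nonneg {ι E : Type*} [Fintype ι] [NormedAddCommGroup E]
    [NormedSpace ℝ E] (T : (ι → ℝ) →ₗ[ℝ] E) : IsClosed (T '' {x | 0 ≤ x}) := by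
  classical
  let W : Finset ι → Submodule ℝ (ι → ℝ) := fun I =>
    { carrier := {x | ∀ i ∉ I, x i = 0}
      add_mem' := fun {a b} ha hb i hi => by simp [ha i hi, hb i hi]
      zero_mem' := fun i _ => rfl
      smul_mem' := fun c x hx i hi => by simp [hx i hi] }
  let K : Finset ι → Set E := fun I => T.domRestrict (W I) '' {w | 0 ≤ (w : ι → ℝ)}
  have hK : ∀ I, LinearMap.ker (T.domRestrict (W I)) = ⊥ → IsClosed (K I) := fun I hI =>
    (LinearMap.isClosedEmbedding_of_injective hI).isClosedMap _
      (isClosed_Ici.preimage continuous_subtype_val)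
  have hcar : ∀ n, ∀ x : ι → ℝ, 0 ≤ x → (Finset.univ.filter fun i => x i ≠ 0).card = n →
      ∃ I, LinearMap.ker (T.domRestrict (W I)) = ⊥ ∧ T x ∈ K I := by
    intro n
    induction n using Nat.strong_induction_on with
    | _ n ih =>
    intro x hx hn
    set I := Finset.univ.filter fun i => x i ≠ 0 with hI
    by_cases hker : LinearMap.ker (T.domRestrict (W I)) = ⊥
    · exact ⟨I, hker, ⟨x, fun i hi => by simpa [hI] using hi⟩, hx, rfl⟩
    obtain ⟨⟨d, hdW⟩, hdT, hd0⟩ := (Submodule.ne_bot_iff _).1 hker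
    have hdT : T d = 0 := hdT
    have hd0 : d ≠ 0 := fun h => hd0 (Subtype.ext h)
    have hex : ∃ d : ι → ℝ, d ∈ W I ∧ T d = 0 ∧ ∃ i, 0 < d i := by
      obtain ⟨i, hi⟩ := Function.ne_iff.1 hd0
      rcases lt_or_gt_of_ne hi with h | h
      · exact ⟨-d, (W I).neg_mem hdW, by simp [hdT], i, by simpa using h⟩
      · exact ⟨d, hdW, hdT, i, h⟩
    clear! d
    obtain ⟨d, hdW, hdT, i, hi⟩ := hex
    obtain ⟨j, hj, hmin⟩ := Finset.exists_min_image (Finset.univ.filter fun i => 0 < d i)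
      (fun i => x i / d i) ⟨i, by simpa using hi⟩
    replace hj : 0 < d j := by simpa using hj
    set t := x j / d j
    have ht : 0 ≤ t := div_nonneg (hx j) hj.le
    have hx' : 0 ≤ x - t • d := by
      intro i
      simp only [Pi.zero_apply, Pi.sub_apply, Pi.smul_apply, smul_eq_mul, sub_nonneg]
      rcases lt_or_ge 0 (d i) with h | h
      · exact (le_div_iff₀ h).1 (hmin i (by simpa using h))
      · exact (mul_nonpos_of_nonneg_of_nonpos ht h).trans (hx i)
    have hxj : x j ≠ 0 := fun h => hj.ne' (hdW j (by simp [hI, h]))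
    have hlt : (Finset.univ.filter fun i => (x - t • d) i ≠ 0).card < n := by
      rw [← hn]
      refine Finset.card_lt_card ((Finset.ssubset_iff_of_subset ?_).2 ⟨j, ?_, ?_⟩)
      · intro i hi
        by_contra h
        have h1 : x i = 0 := by simpa [hI] using h
        simp [h1, hdW i h] at hi
      · simp [hI, hxj]
      · simp [t, hj.ne']
    obtain ⟨J, hJ, hJT⟩ := ih _ hlt _ hx' rfl
    refine ⟨J, hJ, ?_⟩
    simpa [hdT] using hJT
  have : T '' {x | 0 ≤ x} = ⋃ I ∈ {I | LinearMap.ker (T.domRestrict (W I)) = ⊥}, K I := by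
    ext y
    simp only [Set.mem_iUnion, Set.mem_ofPred_eq, exists_prop]
    constructor
    · rintro ⟨x, hx, rfl⟩
      exact hcar _ x hx rfl
    · rintro ⟨I, -, w, hw, rfl⟩
      exact ⟨w, hw, rfl⟩
  rw [this]
  exact (Set.toFinite _).isClosed_biUnion fun I hI => hK I hI

namespace MDP

section Flow

variable {V A : Type} [Fintype V] [Fintype A] (M : MDP V A)

open Classical in
/-- The uniform distribution on the enabled actions. -/
noncomputable def unifAct (v : V) (a : A) : ℝ :=
  if a ∈ M.enabled v then ((M.enabled v).card : ℝ)⁻¹ else 0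

lemma unifAct_nonneg (v : V) (a : A) : 0 ≤ M.unifAct v a := by
  unfold unifAct
  split_ifs <;> positivity

lemma unifAct_pos {v : V} {a : A} (ha : a ∈ M.enabled v) : 0 < M.unifAct v a := by
  have := Finset.card_pos.2 ⟨a, ha⟩
  simp only [unifAct, ha, if_true]
  positivity

lemma unifAct_of_notMem {v : V} {a : A} (ha : a ∉ M.enabled v) : M.unifAct v a = 0 := by
  simp [unifAct, ha]

lemma sum_enabled_unifAct (v : V) : ∑ a ∈ M.enabled v, M.unifAct v a = 1 := by
  have h : ∀ a ∈ M.enabled v, M.unifAct v a = ((M.enabled v).card : ℝ)⁻¹ := fun a ha => by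
    simp [unifAct, ha]
  have := Finset.card_pos.2 (M.enabled_nonempty v)
  rw [Finset.sum_congr rfl h, Finset.sum_const, nsmul_eq_mul, mul_inv_cancel₀ (by positivity)]

/-- The transition matrix of the uniform strategy. -/
noncomputable def unifP (v w : V) : ℝ := ∑ a ∈ M.enabled v, M.unifAct v a * M.p v a w

lemma unifP_nonneg (v w : V) : 0 ≤ M.unifP v w :=
  Finset.sum_nonneg fun a _ => mul_nonneg (M.unifAct_nonneg v a) (M.p_nonneg v a w)

lemma unifP_pos {v w : V} (h : M.Step v w) : 0 < M.unifP v w := by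
  obtain ⟨a, ha, hp⟩ := h
  exact Finset.sum_pos' (fun a _ => mul_nonneg (M.unifAct_nonneg v a) (M.p_nonneg v a w))
    ⟨a, ha, mul_pos (M.unifAct_pos ha) hp⟩

lemma sum_unifP (v : V) : ∑ w, M.unifP v w = 1 := by
  unfold unifP
  rw [Finset.sum_comm, ← M.sum_enabled_unifAct v]
  refine Finset.sum_congr rfl fun a ha => ?_
  rw [← Finset.mul_sum, M.p_sum v a ha, mul_one]

variable [DecidableEq V] {F : Finset V}

/-- Minimum principle for the uniform strategy killed on `F`. -/
lemma CleanedUp.nonneg_of_superharmonic {M : MDP V A} (hM : M.CleanedUp (F : Set V)) {h : V → ℝ}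
    (hF : ∀ v ∈ F, 0 ≤ h v) (hc : ∀ v ∉ F, ∑ w ∈ Fᶜ, M.unifP v w * h w ≤ h v) (v : V) :
    0 ≤ h v := by
  obtain ⟨u, -, hu⟩ := Finset.exists_min_image Finset.univ h ⟨v, Finset.mem_univ v⟩
  by_contra! hv
  have hneg : h u < 0 := (hu v (Finset.mem_univ v)).trans_lt hv
  have hstep : ∀ v w, h v = h u → M.Step v w → h w = h u := by
    intro v w hvu hvw
    have hvF : v ∉ F := fun hv => by linarith [hF v hv]
    have hterm : ∀ w, 0 ≤ M.unifP v w * ((if w ∈ Fᶜ then h w else 0) - h u) := by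
      intro w
      refine mul_nonneg (M.unifP_nonneg v w) (sub_nonneg.2 ?_)
      split_ifs
      · exact hu w (Finset.mem_univ w)
      · exact hneg.le
    have hsum : ∑ w, M.unifP v w * ((if w ∈ Fᶜ then h w else 0) - h u) ≤ 0 := by
      simp only [mul_sub, Finset.sum_sub_distrib, ← Finset.sum_mul, sum_unifP, mul_ite, mul_zero,
        Finset.sum_ite_mem, Finset.univ_inter]
      linarith [hc v hvF]
    have hz := (Finset.sum_eq_zero_iff_of_nonneg fun w _ => hterm w).1
      (le_antisymm hsum (Finset.sum_nonneg fun w _ => hterm w)) w (Finset.mem_univ w)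
    rcases mul_eq_zero.1 hz with h0 | h0
    · exact absurd h0 (M.unifP_pos hvw).ne'
    · split_ifs at h0 <;> linarith
  obtain ⟨w, hw, hpath⟩ := hM u
  have : h w = h u := by
    clear hw
    induction hpath with
    | refl => rfl
    | tail _ hs ih => exact hstep _ _ ih hs
  linarith [hF w hw]

/-- The uniform strategy routes any nonnegative supply to `F` by a finite flow. -/
lemma CleanedUp.exists_unif_flow {M : MDP V A} (hM : M.CleanedUp (F : Set V)) {ρ : V → ℝ}
    (hρ : ∀ v, 0 ≤ ρ v) :
    ∃ z : V → ℝ, (∀ v, 0 ≤ z v) ∧ ∀ v ∉ F, z v - ∑ u ∈ Fᶜ, z u * M.unifP u v = ρ v := by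
  let Q : Matrix V V ℝ := fun u v => if u ∉ F ∧ v ∉ F then M.unifP u v else 0
  have hmono : ∀ h : V → ℝ, 0 ≤ (1 - Q).mulVec h → ∀ v, 0 ≤ h v := by
    intro h hh
    have hQ : ∀ v, (Q.mulVec h) v ≤ h v := fun v => by
      have := hh v
      rw [Matrix.sub_mulVec, Matrix.one_mulVec] at this
      simpa using this
    refine hM.nonneg_of_superharmonic (fun v hv => ?_) fun v hv => ?_
    · simpa [Matrix.mulVec, dotProduct, Q, hv] using hQ v
    · refine le_of_eq_of_le ?_ (hQ v)
      simp only [Matrix.mulVec, dotProduct, Q, Finset.mem_compl.2 hv, true_and, ite_mul, zero_mul,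
        ← Finset.mem_compl, Finset.sum_ite_mem, Finset.univ_inter]
  have hinj : Function.Injective (1 - Q).mulVec := by
    intro x y hxy
    have h1 := hmono (x - y) (by rw [Matrix.mulVec_sub, hxy, sub_self])
    have h2 := hmono (y - x) (by rw [Matrix.mulVec_sub, hxy, sub_self])
    ext v
    have h3 := h1 v
    have h4 := h2 v
    simp only [Pi.sub_apply] at h3 h4
    linarith
  have hdet : IsUnit (1 - Q).det :=
    (Matrix.isUnit_iff_isUnit_det _).1 (Matrix.mulVec_injective_iff_isUnit.1 hinj)
  set B := (1 - Q)⁻¹ with hB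
  have hBnn : ∀ u v, 0 ≤ B u v := by
    intro u v
    refine hmono (fun w => B w v) ?_ u
    have h1 : (1 - Q) * B = 1 := Matrix.mul_nonsing_inv _ hdet
    intro w
    have h2 : (1 - Q).mulVec (fun w => B w v) w = ((1 - Q) * B) w v := rfl
    rw [h2, h1, Matrix.one_apply]
    split_ifs <;> simp
  refine ⟨Matrix.vecMul ρ B, fun v => Finset.sum_nonneg fun u _ =>
    mul_nonneg (hρ u) (hBnn u v), fun v hv => ?_⟩
  have h1 : Matrix.vecMul (Matrix.vecMul ρ B) (1 - Q) = ρ := by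
    rw [Matrix.vecMul_vecMul, Matrix.nonsing_inv_mul _ hdet, Matrix.vecMul_one]
  have h2 := congrFun h1 v
  rw [Matrix.vecMul_sub, Matrix.vecMul_one] at h2
  refine Eq.trans ?_ h2
  rw [Pi.sub_apply]
  congr 1
  simp only [Matrix.vecMul, dotProduct, Q, Finset.mem_compl.2 hv, and_true, mul_ite, mul_zero,
    ← Finset.mem_compl, Finset.sum_ite_mem, Finset.univ_inter]

/-- The flow that `y` sends from outside `F` into `v`. -/
noncomputable def inflow (F : Finset V) (y : V → A → ℝ) (v : V) : ℝ :=
  ∑ u ∈ Fᶜ, ∑ a ∈ M.enabled u, M.p u a v * y u a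

lemma inflow_mono {y y' : V → A → ℝ} (h : ∀ v ∉ F, ∀ a ∈ M.enabled v, y v a ≤ y' v a) (v : V) :
    M.inflow F y v ≤ M.inflow F y' v :=
  Finset.sum_le_sum fun u hu => Finset.sum_le_sum fun a ha =>
    mul_le_mul_of_nonneg_left (h u (Finset.mem_compl.1 hu) a ha) (M.p_nonneg u a v)

lemma sum_inflow (y : V → A → ℝ) :
    ∑ v, M.inflow F y v = ∑ u ∈ Fᶜ, ∑ a ∈ M.enabled u, y u a := by
  unfold inflow
  rw [Finset.sum_comm]
  refine Finset.sum_congr rfl fun u _ => ?_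
  rw [Finset.sum_comm]
  refine Finset.sum_congr rfl fun a ha => ?_
  rw [← Finset.sum_mul, M.p_sum u a ha, one_mul]

lemma isClosed_lpProj (F : Finset V) (α : V → ℝ) {k : ℕ} (Fi : Fin k → Finset V) :
    IsClosed {r : Fin k → ℝ | ∃ y : V → A → ℝ, (∀ v a, 0 ≤ y v a) ∧
      (∀ v ∉ F, ∑ a ∈ M.enabled v, y v a - M.inflow F y v = α v) ∧
      ∀ i, r i ≤ ∑ v ∈ Fi i, M.inflow F y v} := by
  let I : V → (((V × A) ⊕ Fin k → ℝ) →ₗ[ℝ] ℝ) := fun v =>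
    ∑ u ∈ Fᶜ, ∑ a ∈ M.enabled u, M.p u a v • LinearMap.proj (Sum.inl (u, a))
  let T : ((V × A) ⊕ Fin k → ℝ) →ₗ[ℝ] (V → ℝ) × (Fin k → ℝ) :=
    (LinearMap.pi fun v => if v ∈ F then 0 else
      ∑ a ∈ M.enabled v, LinearMap.proj (Sum.inl (v, a)) - I v).prod
    (LinearMap.pi fun i => ∑ v ∈ Fi i, I v - LinearMap.proj (Sum.inr i))
  have hI : ∀ v x, I v x = M.inflow F (fun u a => x (Sum.inl (u, a))) v := by
    intro v x
    simp [I, inflow, LinearMap.sum_apply]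
  have h1 : ∀ x v, (T x).1 v = if v ∈ F then 0 else
      ∑ a ∈ M.enabled v, x (Sum.inl (v, a)) - M.inflow F (fun u a => x (Sum.inl (u, a))) v := by
    intro x v
    by_cases hv : v ∈ F <;> simp [T, hv, LinearMap.sum_apply, hI]
  have h2 : ∀ x i, (T x).2 i =
      ∑ v ∈ Fi i, M.inflow F (fun u a => x (Sum.inl (u, a))) v - x (Sum.inr i) := by
    intro x i
    simp [T, LinearMap.sum_apply, hI]
  have hcont : Continuous fun r : Fin k → ℝ => ((fun v => if v ∈ F then 0 else α v, r) :
      (V → ℝ) × (Fin k → ℝ)) := by fun_prop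
  convert (T.isClosed_image_nonneg).preimage hcont using 1
  ext r
  simp only [Set.mem_ofPred_eq, Set.mem_preimage, Set.mem_image, Prod.ext_iff, funext_iff, h1, h2]
  constructor
  · rintro ⟨y, hy, hb, hr⟩
    refine ⟨Sum.elim (fun c => y c.1 c.2) fun i => ∑ v ∈ Fi i, M.inflow F y v - r i, ?_, ?_, ?_⟩
    · rintro (c | i)
      · exact hy c.1 c.2
      · exact sub_nonneg.2 (hr i)
    · intro v
      by_cases hv : v ∈ F
      · simp [hv]
      · simpa [hv] using hb v hv
    · intro i
      simp
  · rintro ⟨x, hx, hb, hr⟩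
    refine ⟨fun u a => x (Sum.inl (u, a)), fun v a => hx _, fun v hv => ?_, fun i => ?_⟩
    · simpa [hv] using hb v
    · have := hx (Sum.inr i)
      rw [Pi.zero_apply] at this
      linarith [hr i]

lemma inflow_add (y y' : V → A → ℝ) (v : V) :
    M.inflow F (fun u a => y u a + y' u a) v = M.inflow F y v + M.inflow F y' v := by
  simp [inflow, mul_add, Finset.sum_add_distrib]

lemma inflow_sum (s : Finset ℕ) (y : ℕ → V → A → ℝ) (v : V) :
    M.inflow F (fun u a => ∑ n ∈ s, y n u a) v = ∑ n ∈ s, M.inflow F (y n) v := by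
  simp only [inflow, Finset.mul_sum]
  rw [Finset.sum_comm]
  refine Finset.sum_congr rfl fun u _ => ?_
  rw [Finset.sum_comm]

lemma inflow_unif (z : V → ℝ) (v : V) : M.inflow F (fun u a => z u * M.unifAct u a) v =
    ∑ u ∈ Fᶜ, z u * M.unifP u v := by
  unfold inflow unifP
  refine Finset.sum_congr rfl fun u _ => ?_
  rw [Finset.mul_sum]
  exact Finset.sum_congr rfl fun a _ => by ring

lemma exists_memoryless_of_flow {y : V → A → ℝ} (hy : ∀ v ∉ F, ∀ a ∈ M.enabled v, 0 ≤ y v a) :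
    ∃ σ : M.Strategy, σ.Memoryless ∧ ∀ v ∉ F, ∀ a ∈ M.enabled v,
      y v a = (∑ b ∈ M.enabled v, y v b) * σ.act [] v a := by
  classical
  set X : V → ℝ := fun v => ∑ b ∈ M.enabled v, y v b with hX
  have hX0 : ∀ v ∉ F, 0 ≤ X v := fun v hv => Finset.sum_nonneg (hy v hv)
  refine ⟨⟨fun _ v a => if v ∉ F ∧ X v ≠ 0 then (if a ∈ M.enabled v then y v a / X v else 0)
    else M.unifAct v a, ?_, ?_, ?_⟩, fun _ _ _ => rfl, ?_⟩
  · intro _ v a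
    split_ifs with h ha
    · exact div_nonneg (hy v h.1 a ha) (hX0 v h.1)
    · exact le_rfl
    · exact M.unifAct_nonneg v a
  · intro _ v a ha
    split_ifs
    · rfl
    · exact M.unifAct_of_notMem ha
  · intro _ v
    split_ifs with h
    · rw [Finset.sum_ite_mem, Finset.univ_inter, ← Finset.sum_div]
      exact div_self h.2
    · rw [← M.sum_enabled_unifAct v]
      exact (Finset.sum_subset (Finset.subset_univ _) fun a _ ha => M.unifAct_of_notMem ha).symm
  · intro v hv a ha
    by_cases h : X v = 0
    · have : y v a = 0 := (Finset.sum_eq_zero_iff_of_nonneg (hy v hv)).1 h a ha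
      change y v a = X v * _
      rw [this, h, zero_mul]
    · change y v a = X v * _
      simp only [hv, h, ha, not_false_eq_true, ne_eq, and_self, if_true]
      exact (mul_div_cancel₀ _ h).symm

lemma LPFeasible.convex_combination {M : MDP V A} {α : V → ℝ} {y y' : V → A → ℝ} {yF yF' : V → ℝ}
    (h : M.LPFeasible α F y yF) (h' : M.LPFeasible α F y' yF') {s t : ℝ} (hs : 0 ≤ s) (ht : 0 ≤ t)
    (hst : s + t = 1) :
    M.LPFeasible α F (fun v a => s * y v a + t * y' v a) (fun v => s * yF v + t * yF' v) := by
  have hin : ∀ v, ∑ u ∈ Fᶜ, ∑ a ∈ M.enabled u, M.p u a v * (s * y u a + t * y' u a) =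
      s * ∑ u ∈ Fᶜ, ∑ a ∈ M.enabled u, M.p u a v * y u a +
        t * ∑ u ∈ Fᶜ, ∑ a ∈ M.enabled u, M.p u a v * y' u a := by
    intro v
    simp only [Finset.mul_sum, ← Finset.sum_add_distrib]
    exact Finset.sum_congr rfl fun u _ => Finset.sum_congr rfl fun a _ => by ring
  refine ⟨fun v hv => ?_, fun v hv => ?_, fun v hv => ?_, fun v hv a ha => ?_⟩
  · rw [hin, Finset.sum_add_distrib, ← Finset.mul_sum, ← Finset.mul_sum]
    linear_combination s * h.1 v hv + t * h'.1 v hv + α v * hst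
  · rw [hin]
    linear_combination s * h.2.1 v hv + t * h'.2.1 v hv
  · exact add_nonneg (mul_nonneg hs (h.2.2.1 v hv)) (mul_nonneg ht (h'.2.2.1 v hv))
  · exact add_nonneg (mul_nonneg hs (h.2.2.2 v hv a ha)) (mul_nonneg ht (h'.2.2.2 v hv a ha))

lemma convex_lpSet (α : V → ℝ) (F : Finset V) {k : ℕ} (Fi : Fin k → Finset V) :
    Convex ℝ {r : Fin k → ℝ | (∀ i, 0 ≤ r i ∧ r i ≤ 1) ∧
      ∃ (y : V → A → ℝ) (yF : V → ℝ), M.LPFeasible α F y yF ∧ ∀ i, r i ≤ ∑ v ∈ Fi i, yF v} := by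
  rintro r ⟨hr, y, yF, hy, hry⟩ r' ⟨hr', y', yF', hy', hry'⟩ s t hs ht hst
  refine ⟨fun i => ?_, _, _, hy.convex_combination hy' hs ht hst, fun i => ?_⟩
  · simp only [Pi.add_apply, Pi.smul_apply, smul_eq_mul]
    constructor
    · exact add_nonneg (mul_nonneg hs (hr i).1) (mul_nonneg ht (hr' i).1)
    · nlinarith [mul_le_mul_of_nonneg_left (hr i).2 hs, mul_le_mul_of_nonneg_left (hr' i).2 ht]
  · simp only [Pi.add_apply, Pi.smul_apply, smul_eq_mul, Finset.sum_add_distrib, ← Finset.mul_sum]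
    exact add_le_add (mul_le_mul_of_nonneg_left (hry i) hs) (mul_le_mul_of_nonneg_left (hry' i) ht)

end Flow

end MDP

namespace MDP

section Main

variable {V A : Type} [Fintype V] [Fintype A] [Nonempty V] [Nonempty A] [DecidableEq V]
  (M : MDP V A) (σ : M.Strategy) (α : V → ℝ) {F : Finset V}

lemma inflow_occ (habs : ∀ v ∈ F, M.Absorbing v) (n : ℕ) (w : V) :
    M.inflow F (M.occ σ α n) w =
      M.stateProb σ α (n + 1) w - if w ∈ F then M.stateProb σ α n w else 0 := by
  have h : ∀ v ∈ F, ∑ a ∈ M.enabled v, M.p v a w * M.occ σ α n v a =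
      if w = v then M.stateProb σ α n w else 0 := by
    intro v hv
    split_ifs with hwv
    · subst hwv
      obtain ⟨b, hb, hb1⟩ := habs w hv
      rw [← sum_enabled_occ, hb, Finset.sum_singleton, Finset.sum_singleton, hb1, one_mul]
    · exact Finset.sum_eq_zero fun a ha => by rw [(habs v hv).p_eq_zero ha hwv, zero_mul]
  rw [stateProb_succ, ← Finset.sum_add_sum_compl F, Finset.sum_congr rfl h, Finset.sum_ite_eq,
    inflow, add_sub_cancel_left]

/-- The expected number of times action `a` is played at `v` before time `N`. -/
noncomputable def occSum (N : ℕ) (v : V) (a : A) : ℝ := ∑ n ∈ Finset.range N, M.occ σ α n v a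

lemma inflow_occSum_of_mem {α : V → ℝ} (hα : IsDist α) (hsupp : ∀ v ∈ F, α v = 0)
    (habs : ∀ v ∈ F, M.Absorbing v) (N : ℕ) {v : V} (hv : v ∈ F) :
    M.inflow F (M.occSum σ α N) v = M.stateProb σ α N v := by
  unfold occSum
  rw [inflow_sum]
  simp only [inflow_occ M σ α habs, hv, if_true]
  rw [Finset.sum_range_sub (fun n => M.stateProb σ α n v), stateProb_zero M σ hα,
    hsupp v hv, sub_zero]

lemma inflow_occSum_of_notMem {α : V → ℝ} (habs : ∀ v ∈ F, M.Absorbing v) (N : ℕ)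
    {v : V} (hv : v ∉ F) :
    M.inflow F (M.occSum σ α N) v = ∑ n ∈ Finset.range N, M.stateProb σ α (n + 1) v := by
  unfold occSum
  rw [inflow_sum]
  simp only [inflow_occ M σ α habs, hv, if_false, sub_zero]

/-- The reachability probabilities of a strategy are attained by the linear program. -/
lemma exists_flow_of_strategy {α : V → ℝ} (hα : IsDist α) (hsupp : ∀ v ∈ F, α v = 0)
    (habs : ∀ v ∈ F, M.Absorbing v) (hclean : M.CleanedUp (F : Set V))
    {k : ℕ} (Fi : Fin k → Finset V) (hFi : ∀ i, Fi i ⊆ F) :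
    ∃ y : V → A → ℝ, (∀ v a, 0 ≤ y v a) ∧
      (∀ v ∉ F, ∑ a ∈ M.enabled v, y v a - M.inflow F y v = α v) ∧
      ∀ i, M.PrReach σ α (Fi i : Set V) ≤ ∑ v ∈ Fi i, M.inflow F y v := by
  have hlim : Filter.Tendsto (fun N i => ∑ v ∈ Fi i, M.stateProb σ α N v) Filter.atTop
      (nhds fun i => M.PrReach σ α (Fi i : Set V)) :=
    tendsto_pi_nhds.2 fun i => tendsto_sum_stateProb M σ α fun v hv => habs v (hFi i hv)
  refine (M.isClosed_lpProj F α Fi).mem_of_tendsto hlim (Filter.Eventually.of_forall fun N => ?_)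
  obtain ⟨z, hz, hzρ⟩ := hclean.exists_unif_flow (stateProb_nonneg M σ α N)
  have hzy : ∀ v a, 0 ≤ z v * M.unifAct v a := fun v a => mul_nonneg (hz v) (M.unifAct_nonneg v a)
  refine ⟨fun v a => M.occSum σ α N v a + z v * M.unifAct v a, fun v a => ?_, fun v hv => ?_,
    fun i => Finset.sum_le_sum fun v hv => ?_⟩
  · exact add_nonneg (Finset.sum_nonneg fun n _ => occ_nonneg M σ α n v a) (hzy v a)
  · have h1 : ∑ a ∈ M.enabled v, M.occSum σ α N v a =
        ∑ n ∈ Finset.range N, M.stateProb σ α n v := by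
      unfold occSum
      rw [Finset.sum_comm]
      exact Finset.sum_congr rfl fun n _ => sum_enabled_occ M σ α n v
    have h2 := Finset.sum_range_sub (fun n => M.stateProb σ α n v) N
    rw [Finset.sum_sub_distrib, stateProb_zero M σ hα] at h2
    rw [inflow_add, inflow_occSum_of_notMem M σ habs N hv, inflow_unif, Finset.sum_add_distrib, h1,
      ← Finset.mul_sum, sum_enabled_unifAct]
    linarith [hzρ v hv]
  · rw [inflow_add, inflow_occSum_of_mem M σ hα hsupp habs N (hFi i hv), inflow_unif]
    exact le_add_of_nonneg_right (Finset.sum_nonneg fun u _ =>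
      mul_nonneg (hz u) (M.unifP_nonneg u v))

/-- The memoryless strategy that splits according to an LP solution achieves the LP values. -/
lemma exists_memoryless_of_lpFeasible {α : V → ℝ} (hα : IsDist α) (hsupp : ∀ v ∈ F, α v = 0)
    (habs : ∀ v ∈ F, M.Absorbing v) {y : V → A → ℝ} {yF : V → ℝ} (hy : M.LPFeasible α F y yF) :
    ∃ σ : M.Strategy, σ.Memoryless ∧ ∀ G ⊆ F, ∑ v ∈ G, yF v ≤ M.PrReach σ α (G : Set V) := by
  obtain ⟨hbal, hyF, -, hnn⟩ := hy
  obtain ⟨σ, hσ, hyσ⟩ := M.exists_memoryless_of_flow hnn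
  refine ⟨σ, hσ, fun G hG => ?_⟩
  set X : V → ℝ := fun v => ∑ b ∈ M.enabled v, y v b with hX
  have hbal' : ∀ v ∉ F, X v = α v + M.inflow F y v := fun v hv => by
    rw [← hbal v hv]; simp [hX, inflow]
  have hyF' : ∀ v ∈ F, yF v = M.inflow F y v := fun v hv => sub_eq_zero.1 (hyF v hv)
  have hocc : ∀ N v a, M.occSum σ α N v a =
      (∑ n ∈ Finset.range N, M.stateProb σ α n v) * σ.act [] v a := by
    intro N v a
    rw [occSum, Finset.sum_mul]
    exact Finset.sum_congr rfl fun n _ => occ_memoryless M σ α hσ n v a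
  have hle : ∀ N, ∀ v ∉ F, ∑ n ∈ Finset.range N, M.stateProb σ α n v ≤ X v →
      ∀ a ∈ M.enabled v, M.occSum σ α N v a ≤ y v a := by
    intro N v hv h a ha
    rw [hocc, hyσ v hv a ha]
    exact mul_le_mul_of_nonneg_right h (σ.act_nonneg _ _ _)
  have hS : ∀ N, ∀ v ∉ F, ∑ n ∈ Finset.range N, M.stateProb σ α n v ≤ X v := by
    intro N
    induction N with
    | zero => intro v hv; simpa using Finset.sum_nonneg (hnn v hv)
    | succ N ih =>
      intro v hv
      rw [Finset.sum_range_succ', stateProb_zero M σ hα, ← inflow_occSum_of_notMem M σ habs N hv,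
        hbal' v hv, add_comm]
      exact add_le_add_right (M.inflow_mono (fun u hu a ha => hle N u hu (ih u hu) a ha) v) _
  have hdom : ∀ N, ∀ v ∈ F, M.stateProb σ α N v ≤ yF v := by
    intro N v hv
    rw [hyF' v hv, ← inflow_occSum_of_mem M σ hα hsupp habs N hv]
    exact M.inflow_mono (fun u hu a ha => hle N u hu (hS N u hu) a ha) v
  set e : ℕ → ℝ := fun N => ∑ v ∈ Fᶜ, M.stateProb σ α N v with he
  have he0 : Filter.Tendsto e Filter.atTop (nhds 0) := by
    refine (summable_of_sum_range_le (c := ∑ v ∈ Fᶜ, X v)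
      (fun n => Finset.sum_nonneg fun v _ => stateProb_nonneg M σ α n v)
      fun N => ?_).tendsto_atTop_zero
    rw [Finset.sum_comm]
    exact Finset.sum_le_sum fun v hv => hS N v (Finset.mem_compl.1 hv)
  have htotal : ∑ v ∈ F, yF v = 1 := by
    have h1 : ∑ v ∈ Fᶜ, X v = _ := (M.sum_inflow (F := F) y).symm
    rw [← Finset.sum_add_sum_compl F, ← Finset.sum_congr rfl hyF',
      Finset.sum_congr rfl fun v hv => hbal' v (Finset.mem_compl.1 hv),
      Finset.sum_add_distrib] at h1
    have h2 := hα.2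
    rw [← Finset.sum_add_sum_compl F, Finset.sum_eq_zero hsupp] at h2
    linarith
  have hbound : ∀ N, ∑ v ∈ G, yF v ≤ M.PrReach σ α (G : Set V) + e N := by
    intro N
    have h1 := sum_stateProb M σ α N
    rw [← Finset.sum_add_sum_compl F] at h1
    have h2 : ∑ v ∈ G, (yF v - M.stateProb σ α N v) ≤ ∑ v ∈ F, (yF v - M.stateProb σ α N v) :=
      Finset.sum_le_sum_of_subset_of_nonneg hG fun v hv _ => sub_nonneg.2 (hdom N v hv)
    rw [Finset.sum_sub_distrib, Finset.sum_sub_distrib] at h2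
    have h3 := sum_stateProb_le_prReach M σ α N G
    have h4 : e N = ∑ v ∈ Fᶜ, M.stateProb σ α N v := rfl
    linarith
  have := he0.const_add (M.PrReach σ α (G : Set V))
  rw [add_zero] at this
  exact ge_of_tendsto' this hbound

end Main

end MDP

open MDP in
/-- For a cleaned-up MDP with absorbing targets, the achievable set `U` is a convex
polytope — namely the projection onto the `r`-coordinates of the LP polyhedron
(with the constraints `∑_{v ∈ F_i} y_v ≥ r_i`) intersected with `[0,1]^k` — and is
downward closed; the same holds for the memorylessly achievable set `U^⊙`, and
`U = U^⊙`. -/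
theorem achievable_set_is_lp_projection_and_downward_closed
    {V A : Type} [Fintype V] [Fintype A] [Nonempty V] [Nonempty A] [DecidableEq V]
    (M : MDP V A) {k : ℕ} (Fi : Fin k → Finset V) (F : Finset V)
    (hF : F = Finset.univ.biUnion Fi)
    (habs : ∀ v ∈ F, M.Absorbing v)
    (hclean : M.CleanedUp (↑F : Set V))
    (α : V → ℝ) (hα : IsDist α) (hsupp : ∀ v ∈ F, α v = 0) :
    (M.achSet α Fi =
      {r : Fin k → ℝ | (∀ i, 0 ≤ r i ∧ r i ≤ 1) ∧
        ∃ (y : V → A → ℝ) (yF : V → ℝ), M.LPFeasible α F y yF ∧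
          ∀ i, r i ≤ ∑ v ∈ Fi i, yF v}) ∧
    Convex ℝ (M.achSet α Fi) ∧
    (∀ r ∈ M.achSet α Fi, ∀ r' : Fin k → ℝ,
      (∀ i, 0 ≤ r' i) → (∀ i, r' i ≤ r i) → r' ∈ M.achSet α Fi) ∧
    Convex ℝ (M.achSetML α Fi) ∧
    (∀ r ∈ M.achSetML α Fi, ∀ r' : Fin k → ℝ,
      (∀ i, 0 ≤ r' i) → (∀ i, r' i ≤ r i) → r' ∈ M.achSetML α Fi) ∧
    M.achSet α Fi = M.achSetML α Fi := by
  have hFi : ∀ i, Fi i ⊆ F := fun i => hF ▸ Finset.subset_biUnion_of_mem Fi (Finset.mem_univ i)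
  set L : Set (Fin k → ℝ) := {r : Fin k → ℝ | (∀ i, 0 ≤ r i ∧ r i ≤ 1) ∧
    ∃ (y : V → A → ℝ) (yF : V → ℝ), M.LPFeasible α F y yF ∧ ∀ i, r i ≤ ∑ v ∈ Fi i, yF v} with hL
  have hUL : M.achSet α Fi ⊆ L := by
    rintro r ⟨hr0, σ, hr⟩
    obtain ⟨y, hy, hbal, hreach⟩ := M.exists_flow_of_strategy σ hα hsupp habs hclean Fi hFi
    refine ⟨fun i => ⟨hr0 i, (hr i).trans (M.prReach_le_one σ α _)⟩, y, M.inflow F y,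
      ⟨hbal, fun v _ => sub_self _, fun v _ => ?_, fun v _ a _ => hy v a⟩,
      fun i => (hr i).trans (hreach i)⟩
    exact Finset.sum_nonneg fun u _ => Finset.sum_nonneg fun a _ =>
      mul_nonneg (M.p_nonneg u a v) (hy u a)
  have hLML : L ⊆ M.achSetML α Fi := by
    rintro r ⟨hr, y, yF, hy, hry⟩
    obtain ⟨σ, hσ, hreach⟩ := M.exists_memoryless_of_lpFeasible hα hsupp habs hy
    exact ⟨fun i => (hr i).1, σ, hσ, fun i => (hry i).trans (hreach (Fi i) (hFi i))⟩
  have hMLU : M.achSetML α Fi ⊆ M.achSet α Fi := fun r ⟨hr0, σ, _, hr⟩ => ⟨hr0, σ, hr⟩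
  have hU : M.achSet α Fi = L := hUL.antisymm (hLML.trans hMLU)
  have hML : M.achSetML α Fi = L := (hMLU.trans hUL).antisymm hLML
  have hconv : Convex ℝ L := M.convex_lpSet α F Fi
  refine ⟨hU, hU ▸ hconv, ?_, hML ▸ hconv, ?_, hU.trans hML.symm⟩
  · rintro r ⟨_, σ, hr⟩ r' h0 hle
    exact ⟨h0, σ, fun i => (hle i).trans (hr i)⟩
  · rintro r ⟨_, σ, hσ, hr⟩ r' h0 hle
    exact ⟨h0, σ, hσ, fun i => (hle i).trans (hr i)⟩
end

section
/- Let M be a cleaned-up MDP with target sets F_1,…,F_k, F = ∪_i F_i, every state of F absorbing, and initial distribution α on V∖F, and let U ⊆ [0,1]^k be its achievable set for the reachability objectives ◇F_1,…,◇F_k. Then every Pareto-optimal extreme point v of U equals the value vector t^σ = (Pr^σ_α(◇F_1),…,Pr^σ_α(◇F_k)) of some pure memoryless strategy σ. -/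
open scoped BigOperators
open MeasureTheory

namespace MDP

/-- Lebesgue measure on the unit interval. -/
noncomputable def unitMeasure : Measure ℝ := volume.restrict (Set.Ico 0 1)

instance : IsProbabilityMeasure unitMeasure :=
  ⟨by simp [unitMeasure]⟩

lemma measurable_digits (j : ℕ) : Measurable fun x : ℝ => Real.digits x 2 j := by
  unfold Real.digits
  exact (measurable_of_countable (Fin.ofNat 2)).comp (by fun_prop)

lemma digits_two_succ {x : ℝ} {b : Fin 2} (h : 0 ≤ 2 * x - (b : ℝ)) (j : ℕ) :
    Real.digits x 2 (j + 1) = Real.digits (2 * x - (b : ℝ)) 2 j := by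
  unfold Real.digits
  have e : x * (2 : ℝ) ^ (j + 1 + 1) =
      (2 * x - (b : ℝ)) * 2 ^ (j + 1) + ((b.val * 2 ^ (j + 1) : ℕ) : ℝ) := by
    push_cast; ring
  have e' : ⌊x * ((2 : ℕ) : ℝ) ^ (j + 1 + 1)⌋₊ =
      ⌊(2 * x - (b : ℝ)) * ((2 : ℕ) : ℝ) ^ (j + 1)⌋₊ + b.val * 2 ^ (j + 1) := by
    push_cast
    rw [e, Nat.floor_add_natCast (by positivity)]
  rw [e']
  ext
  simp only [Fin.ofNat, pow_succ, ← mul_assoc, Nat.add_mul_mod_self_right]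

lemma digits_two_zero_eq_iff {x : ℝ} (hx : x ∈ Set.Ico (0 : ℝ) 1) (b : Fin 2) :
    Real.digits x 2 0 = b ↔ 2 * x - (b : ℝ) ∈ Set.Ico (0 : ℝ) 1 := by
  obtain ⟨h0, h1⟩ := hx
  have hlt : ⌊x * ((2 : ℕ) : ℝ) ^ (0 + 1)⌋₊ < 2 := by
    rw [Nat.floor_lt (by positivity)]; push_cast; linarith
  have : Real.digits x 2 0 = b ↔ ⌊x * ((2 : ℕ) : ℝ) ^ (0 + 1)⌋₊ = b.val := by
    unfold Real.digits
    rw [Fin.ext_iff]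
    simp only [Fin.ofNat, Nat.mod_eq_of_lt hlt]
  rw [this, Nat.floor_eq_iff (by positivity), Set.mem_Ico]
  push_cast
  constructor <;> rintro ⟨h2, h3⟩ <;> constructor <;> linarith

lemma volume_preimage_two_mul_sub (b : ℝ) (s : Set ℝ) :
    volume ((fun x : ℝ => 2 * x - b) ⁻¹' s) = 2⁻¹ * volume s := by
  have : (fun x : ℝ => 2 * x - b) ⁻¹' s = (2 * ·) ⁻¹' ((fun y => y + -b) ⁻¹' s) := by
    ext x; simp [sub_eq_add_neg]
  rw [this, Real.volume_preimage_mul_left two_ne_zero, measure_preimage_add_right]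
  congr 1
  rw [abs_of_pos (by norm_num), ENNReal.ofReal_inv_of_pos two_pos]
  simp

lemma unitMeasure_digit_cons (b : Fin 2) {s s' : Set ℝ}
    (hs : MeasurableSet s) (hs' : MeasurableSet s')
    (h : ∀ x, 0 ≤ 2 * x - (b : ℝ) → (x ∈ s' ↔ 2 * x - (b : ℝ) ∈ s)) :
    unitMeasure ({x | Real.digits x 2 0 = b} ∩ s') = 2⁻¹ * unitMeasure s := by
  have hm : MeasurableSet {x : ℝ | Real.digits x 2 0 = b} :=
    measurable_digits 0 (measurableSet_singleton b)
  rw [unitMeasure, Measure.restrict_apply (hm.inter hs'), Measure.restrict_apply hs,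
    ← volume_preimage_two_mul_sub (b : ℝ)]
  congr 1
  ext x
  simp only [Set.mem_inter_iff, Set.mem_ofPred_eq, Set.mem_preimage]
  constructor
  · rintro ⟨⟨h1, h2⟩, h3⟩
    have := (digits_two_zero_eq_iff h3 b).1 h1
    exact ⟨(h x this.1).1 h2, this⟩
  · rintro ⟨h1, h2⟩
    have hb : (b : ℝ) ≤ 1 := by
      have := b.2
      exact_mod_cast Nat.lt_succ_iff.1 this
    have hb0 : (0 : ℝ) ≤ (b : ℝ) := by positivity
    have hx : x ∈ Set.Ico (0 : ℝ) 1 := ⟨by linarith [h2.1], by linarith [h2.2]⟩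
    exact ⟨⟨(digits_two_zero_eq_iff hx b).2 h2, (h x h2.1).2 h1⟩, hx⟩

/-- The law of a single binary digit. -/
noncomputable def digitMeasure : Measure (Fin 2) :=
  unitMeasure.map fun x => Real.digits x 2 0

instance : IsProbabilityMeasure digitMeasure :=
  Measure.isProbabilityMeasure_map (measurable_digits 0).aemeasurable

lemma unitMeasure_digit_inter (t : Set (Fin 2)) {s s' : Set ℝ}
    (hs : MeasurableSet s) (hs' : MeasurableSet s')
    (h : ∀ (b : Fin 2) (x : ℝ), 0 ≤ 2 * x - (b : ℝ) → (x ∈ s' ↔ 2 * x - (b : ℝ) ∈ s)) :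
    unitMeasure ({x | Real.digits x 2 0 ∈ t} ∩ s') = digitMeasure t * unitMeasure s := by
  classical
  have key : ∀ {r r' : Set ℝ}, MeasurableSet r → MeasurableSet r' →
      (∀ (b : Fin 2) (x : ℝ), 0 ≤ 2 * x - (b : ℝ) → (x ∈ r' ↔ 2 * x - (b : ℝ) ∈ r)) →
      unitMeasure ({x | Real.digits x 2 0 ∈ t} ∩ r') =
        ∑ b ∈ t.toFinset, 2⁻¹ * unitMeasure r := by
    intro r r' hr hr' hrr
    have e : {x | Real.digits x 2 0 ∈ t} ∩ r' =
        ⋃ b ∈ t.toFinset, {x | Real.digits x 2 0 = b} ∩ r' := by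
      ext x; simp
    rw [e, measure_biUnion_finset]
    · exact Finset.sum_congr rfl fun b _ => unitMeasure_digit_cons b hr hr' (hrr b)
    · intro b _ c _ hbc
      refine Set.disjoint_left.2 fun x hx hx' => hbc ?_
      exact hx.1.symm.trans hx'.1
    · exact fun b _ => (measurable_digits 0 (measurableSet_singleton b)).inter hr'
  have h1 : digitMeasure t = ∑ b ∈ t.toFinset, 2⁻¹ * unitMeasure Set.univ := by
    rw [← key .univ .univ (by simp), Set.inter_univ, digitMeasure,
      Measure.map_apply (measurable_digits 0) (Set.toFinite t).measurableSet]
    rfl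
  rw [key hs hs' h, h1]
  simp [mul_assoc]

lemma unitMeasure_digits_lt (m : ℕ) (t : ℕ → Set (Fin 2)) :
    unitMeasure {x | ∀ j < m, Real.digits x 2 j ∈ t j} =
      ∏ j ∈ Finset.range m, digitMeasure (t j) := by
  induction m generalizing t with
  | zero => simp
  | succ m ih =>
    have hmeas : ∀ (a : ℕ) (r : ℕ → Set (Fin 2)),
        MeasurableSet {x : ℝ | ∀ j < m, Real.digits x 2 (j + a) ∈ r j} := by
      intro a r
      have : {x : ℝ | ∀ j < m, Real.digits x 2 (j + a) ∈ r j} =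
          ⋂ j, ⋂ (_ : j < m), (fun x => Real.digits x 2 (j + a)) ⁻¹' r j := by
        ext x; simp
      rw [this]
      exact MeasurableSet.iInter fun j => MeasurableSet.iInter fun _ =>
        measurable_digits _ (Set.toFinite _).measurableSet
    have e : {x | ∀ j < m + 1, Real.digits x 2 j ∈ t j} =
        {x | Real.digits x 2 0 ∈ t 0} ∩
          {x | ∀ j < m, Real.digits x 2 (j + 1) ∈ t (j + 1)} := by
      ext x
      simp only [Set.mem_ofPred_eq, Set.mem_inter_iff]
      constructor
      · exact fun h => ⟨h 0 (by omega), fun j hj => h (j + 1) (by omega)⟩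
      · rintro ⟨h0, h1⟩ (_ | j) hj
        · exact h0
        · exact h1 j (by omega)
    rw [e, unitMeasure_digit_inter (t 0) (hmeas 0 fun j => t (j + 1)) (hmeas 1 _) ?_,
      Finset.prod_range_succ', mul_comm]
    · congr 1
      exact ih fun j => t (j + 1)
    · intro b x hx
      simp only [Set.mem_ofPred_eq, digits_two_succ hx, add_zero]

lemma unitMeasure_map_digits :
    unitMeasure.map (fun x => Real.digits x 2) = Measure.infinitePi fun _ => digitMeasure := by
  classical
  refine Measure.eq_infinitePi _ fun s t ht => ?_
  rw [Measure.map_apply (measurable_pi_lambda _ measurable_digits)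
    (.pi s.countable_toSet fun i _ => ht i)]
  obtain ⟨m, hm⟩ : ∃ m, s ⊆ Finset.range m := ⟨s.sup id + 1, fun i hi =>
    Finset.mem_range.2 (Nat.lt_succ_of_le (Finset.le_sup (f := id) hi))⟩
  have e : (fun x => Real.digits x 2) ⁻¹' Set.pi s t =
      {x | ∀ j < m, Real.digits x 2 j ∈ if j ∈ s then t j else Set.univ} := by
    ext x
    simp only [Set.mem_preimage, Set.mem_pi, Finset.mem_coe, Set.mem_ofPred_eq]
    constructor
    · intro h j _
      split_ifs with hj
      · exact h j hj
      · trivial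
    · intro h j hj
      have := h j (Finset.mem_range.1 (hm hj))
      rwa [if_pos hj] at this
  rw [e, unitMeasure_digits_lt, ← Finset.prod_subset hm]
  · exact Finset.prod_congr rfl fun j hj => by rw [if_pos hj]
  · intro j _ hj
    simp [hj]

lemma infinitePi_digitMeasure_map_ofDigits :
    (Measure.infinitePi fun _ : ℕ => digitMeasure).map Real.ofDigits = unitMeasure := by
  rw [← unitMeasure_map_digits, Measure.map_map Real.continuous_ofDigits.measurable
    (measurable_pi_lambda _ measurable_digits)]
  have : (Real.ofDigits ∘ fun x : ℝ => Real.digits x 2) =ᵐ[unitMeasure] id := by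
    refine (ae_restrict_iff' measurableSet_Ico).2 (Filter.Eventually.of_forall fun x hx => ?_)
    exact Real.ofDigits_digits one_lt_two hx
  rw [Measure.map_congr this, Measure.map_id]

/-- The `k`-th sample extracted from the binary digits of the seed. -/
noncomputable def digitSample (k : ℕ) (x : ℝ) : ℝ :=
  Real.ofDigits fun n => Real.digits x 2 (Nat.pair k n)

lemma measurable_digitSample (k : ℕ) : Measurable (digitSample k) :=
  Real.continuous_ofDigits.measurable.comp
    (measurable_pi_lambda _ fun n => measurable_digits (Nat.pair k n))

lemma unif_eq_digitSample {x : ℝ} (hx : 0 ≤ x) (k : ℕ) : unif k x = digitSample k x := by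
  unfold unif digitSample Real.ofDigits
  congr 1
  ext n
  unfold Real.ofDigitsTerm bit Real.digits
  rw [div_eq_mul_inv]
  push_cast
  congr 1
  have hf : ⌊x * 2 ^ (Nat.pair k n + 1)⌋ = ((⌊x * 2 ^ (Nat.pair k n + 1)⌋₊ : ℕ) : ℤ) :=
    (Int.natCast_floor_eq_floor (by positivity)).symm
  rw [hf]
  rcases Nat.mod_two_eq_zero_or_one ⌊x * 2 ^ (Nat.pair k n + 1)⌋₊ with h | h
  · rw [if_neg (by omega)]
    simp [h]
  · rw [if_pos (by omega)]
    simp [h]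

lemma unitMeasure_map_digitSample_pi :
    unitMeasure.map (fun x k => digitSample k x) = Measure.infinitePi fun _ => unitMeasure := by
  have hc : unitMeasure.map (fun x k => digitSample k x) =
      (((unitMeasure.map fun x => Real.digits x 2).map
        (MeasurableEquiv.piCongrLeft (fun _ => Fin 2) Nat.pairEquiv.symm)).map
        (MeasurableEquiv.curry ℕ ℕ (Fin 2))).map fun d k => Real.ofDigits (d k) := by
    have h1 : Measurable fun x : ℝ => Real.digits x 2 :=
      measurable_pi_lambda _ measurable_digits
    have h2 : Measurable fun (d : ℕ → ℕ → Fin 2) (k : ℕ) => Real.ofDigits (d k) :=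
      measurable_pi_lambda _ fun k =>
        Real.continuous_ofDigits.measurable.comp (measurable_pi_apply k)
    have h3 := (MeasurableEquiv.curry ℕ ℕ (Fin 2)).measurable
    have h4 := (MeasurableEquiv.piCongrLeft (fun _ => Fin 2) Nat.pairEquiv.symm).measurable
    rw [Measure.map_map h2 h3, Measure.map_map (h2.comp h3) h4,
      Measure.map_map ((h2.comp h3).comp h4) h1]
    congr 1
    ext x k
    simp only [digitSample, Function.comp_apply]
    congr 1
    ext n
    exact congrArg Fin.val (MeasurableEquiv.piCongrLeft_apply_apply (β := fun _ => Fin 2)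
      Nat.pairEquiv.symm (Real.digits x 2) (Nat.pair k n) |>.symm.trans (by simp))
  rw [hc, unitMeasure_map_digits,
    Measure.infinitePi_map_piCongrLeft (X := fun _ => Fin 2) (fun _ : ℕ × ℕ => digitMeasure)
      Nat.pairEquiv.symm,
    Measure.infinitePi_map_curry fun _ _ : ℕ => digitMeasure,
    Measure.infinitePi_map_pi (X := fun _ : ℕ => ℕ → Fin 2)
      (μ := fun _ => Measure.infinitePi fun _ : ℕ => digitMeasure)
      fun _ => Real.continuous_ofDigits.measurable,
    infinitePi_digitMeasure_map_ofDigits]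

lemma unitMeasure_digitSample_lt (m : ℕ) {B : ℕ → Set ℝ} (hB : ∀ j, MeasurableSet (B j)) :
    unitMeasure {x | ∀ j < m, digitSample j x ∈ B j} =
      ∏ j ∈ Finset.range m, unitMeasure (B j) := by
  rw [← Measure.infinitePi_pi (μ := fun _ : ℕ => unitMeasure) fun i _ => hB i,
    ← unitMeasure_map_digitSample_pi,
    Measure.map_apply (measurable_pi_lambda _ measurable_digitSample)
      (.pi (Finset.countable_toSet _) fun i _ => hB i)]
  congr 1
  ext x
  simp

end MDP

namespace MDP

section Sampling

variable {S : Type} [Fintype S] [Nonempty S]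

lemma sample_eq_iff {q : S → ℝ} {u : ℝ}
    (hu : ∃ i, u < ∑ j ∈ Finset.Iic i, q ((Fintype.equivFin S).symm j)) (c : S) :
    sample q u = c ↔
      u < ∑ j ∈ Finset.Iic (Fintype.equivFin S c), q ((Fintype.equivFin S).symm j) ∧
      ∀ i < Fintype.equivFin S c,
        ∑ j ∈ Finset.Iic i, q ((Fintype.equivFin S).symm j) ≤ u := by
  have hne : (Finset.univ.filter fun i =>
      u < ∑ j ∈ Finset.Iic i, q ((Fintype.equivFin S).symm j)).Nonempty := by
    obtain ⟨i, hi⟩ := hu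
    exact ⟨i, by simpa using hi⟩
  unfold sample
  simp only [dif_pos hne]
  rw [Equiv.symm_apply_eq, Finset.min'_eq_iff]
  simp only [Finset.mem_filter, Finset.mem_univ, true_and]
  refine and_congr_right fun _ => forall_congr' fun i => ?_
  rw [← not_lt, ← not_lt]
  tauto

lemma measurableSet_sample_s10 (q : S → ℝ) (c : S) : MeasurableSet {u | sample q u = c} := by
  have hlt : ∀ i, MeasurableSet
      {u : ℝ | u < ∑ j ∈ Finset.Iic i, q ((Fintype.equivFin S).symm j)} :=
    fun i => measurableSet_Iio
  have hex : MeasurableSet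
      {u : ℝ | ∃ i, u < ∑ j ∈ Finset.Iic i, q ((Fintype.equivFin S).symm j)} := by
    have := MeasurableSet.iUnion hlt
    convert this using 1
    ext u; simp
  have hchar : MeasurableSet {u : ℝ |
      u < ∑ j ∈ Finset.Iic (Fintype.equivFin S c), q ((Fintype.equivFin S).symm j) ∧
      ∀ i < Fintype.equivFin S c,
        ∑ j ∈ Finset.Iic i, q ((Fintype.equivFin S).symm j) ≤ u} := by
    have h2 : MeasurableSet (⋂ i, ⋂ (_ : i < Fintype.equivFin S c),
        {u : ℝ | ∑ j ∈ Finset.Iic i, q ((Fintype.equivFin S).symm j) ≤ u}) :=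
      MeasurableSet.iInter fun i => MeasurableSet.iInter fun _ => measurableSet_Ici
    convert (hlt (Fintype.equivFin S c)).inter h2 using 1
    ext u; simp
  have e : {u | sample q u = c} =
      ({u : ℝ | ∃ i, u < ∑ j ∈ Finset.Iic i, q ((Fintype.equivFin S).symm j)} ∩ {u : ℝ |
      u < ∑ j ∈ Finset.Iic (Fintype.equivFin S c), q ((Fintype.equivFin S).symm j) ∧
      ∀ i < Fintype.equivFin S c,
        ∑ j ∈ Finset.Iic i, q ((Fintype.equivFin S).symm j) ≤ u}) ∪
      ({u : ℝ | ∃ i, u < ∑ j ∈ Finset.Iic i, q ((Fintype.equivFin S).symm j)}ᶜ ∩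
        {_u : ℝ | Classical.arbitrary S = c}) := by
    ext u
    by_cases hu : ∃ i, u < ∑ j ∈ Finset.Iic i, q ((Fintype.equivFin S).symm j)
    · simp [hu, sample_eq_iff hu]
    · have : ¬ (Finset.univ.filter fun i =>
          u < ∑ j ∈ Finset.Iic i, q ((Fintype.equivFin S).symm j)).Nonempty := by
        rintro ⟨i, hi⟩
        exact hu ⟨i, by simpa using hi⟩
      have hs : sample q u = Classical.arbitrary S := by
        unfold sample
        simp only [dif_neg this]
      simp only [Set.mem_ofPred_eq, Set.mem_union, Set.mem_inter_iff, Set.mem_compl_iff, hu, hs]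
      simp
  rw [e]
  exact (hex.inter hchar).union (hex.compl.inter (MeasurableSet.const _))

lemma unitMeasure_sample {q : S → ℝ} (hq : IsDist q) (c : S) :
    unitMeasure.real {u | sample q u = c} = q c := by
  set e := Fintype.equivFin S with he
  have hq0 : ∀ j, 0 ≤ q (e.symm j) := fun j => hq.1 _
  have htot : ∑ j, q (e.symm j) = 1 := by rw [← hq.2]; exact e.symm.sum_comp q
  have hIic : ∑ j ∈ Finset.Iic (e c), q (e.symm j) =
      ∑ j ∈ Finset.Iio (e c), q (e.symm j) + q c := by
    rw [← Finset.Iio_insert, Finset.sum_insert (by simp), add_comm]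
    simp
  have hset : {u | sample q u = c} ∩ Set.Ico 0 1 =
      Set.Ico (∑ j ∈ Finset.Iio (e c), q (e.symm j)) (∑ j ∈ Finset.Iic (e c), q (e.symm j)) := by
    ext u
    simp only [Set.mem_inter_iff, Set.mem_ofPred_eq, Set.mem_Ico]
    constructor
    · rintro ⟨h, h0, h1⟩
      have hu : ∃ i, u < ∑ j ∈ Finset.Iic i, q (e.symm j) := by
        have hpos : 0 < Fintype.card S := Fintype.card_pos
        refine ⟨⟨Fintype.card S - 1, by omega⟩, ?_⟩
        have : Finset.Iic (⟨Fintype.card S - 1, by omega⟩ : Fin (Fintype.card S)) =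
            Finset.univ := by
          ext j
          simp only [Finset.mem_Iic, Finset.mem_univ, iff_true, Fin.le_def]
          omega
        rw [this, htot]
        exact h1
      rw [sample_eq_iff hu] at h
      refine ⟨?_, h.1⟩
      rcases Nat.eq_zero_or_pos (e c).val with hz | hp
      · have : Finset.Iio (e c) = ∅ := by
          ext j
          simp only [Finset.mem_Iio, Fin.lt_def, hz]
          simp
        rw [this]
        simpa using h0
      · have hlt : (e c).val - 1 < Fintype.card S := by omega
        have : Finset.Iio (e c) = Finset.Iic ⟨(e c).val - 1, hlt⟩ := by
          ext j
          simp only [Finset.mem_Iio, Finset.mem_Iic, Fin.lt_def, Fin.le_def]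
          omega
        rw [this]
        refine h.2 _ ?_
        rw [← he, Fin.lt_def]
        show (e c).val - 1 < (e c).val
        omega
    · rintro ⟨h0, h1⟩
      have hle : ∀ i < e c, ∑ j ∈ Finset.Iic i, q (e.symm j) ≤ u := fun i hi =>
        (Finset.sum_le_sum_of_subset_of_nonneg (fun j hj =>
          Finset.mem_Iio.2 ((Finset.mem_Iic.1 hj).trans_lt hi)) fun j _ _ => hq0 j).trans h0
      refine ⟨(sample_eq_iff ⟨e c, h1⟩ c).2 ⟨h1, hle⟩,
        (Finset.sum_nonneg fun j _ => hq0 j).trans h0, h1.trans_le ?_⟩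
      rw [← htot]
      exact Finset.sum_le_sum_of_subset_of_nonneg (Finset.subset_univ _) fun j _ _ => hq0 j
  rw [measureReal_def, unitMeasure, Measure.restrict_apply' measurableSet_Ico, hset,
    Real.volume_Ico, hIic, add_sub_cancel_left, ENNReal.toReal_ofReal (hq.1 c)]

end Sampling

variable {V A : Type} [Fintype V] [Fintype A]

/-- The distribution of the next state after the history `h`. -/
def nextDist (M : MDP V A) (α : V → ℝ) : List (V × A) → V → ℝ
  | [] => α
  | s :: _ => M.p s.1 s.2

/-- The probability of the finite history `h` of (state, action) pairs. -/
def weight (M : MDP V A) (σ : M.Strategy) (α : V → ℝ) : List (V × A) → ℝ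
  | [] => 1
  | s :: h => weight M σ α h * (M.nextDist α h s.1 * σ.act h s.1 s.2)

lemma Strategy.isDist {M : MDP V A} (σ : M.Strategy) (h : List (V × A)) (v : V) :
    IsDist (σ.act h v) :=
  ⟨σ.act_nonneg h v, σ.act_sum h v⟩

lemma Strategy.enabled_of_act_ne_zero {M : MDP V A} (σ : M.Strategy) {h : List (V × A)} {v : V}
    {a : A} (ha : σ.act h v a ≠ 0) : a ∈ M.enabled v :=
  not_imp_comm.1 (σ.act_support h v a) ha

lemma weight_nonneg (M : MDP V A) (σ : M.Strategy) {α : V → ℝ} (hα : IsDist α)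
    (h : List (V × A)) : 0 ≤ M.weight σ α h := by
  induction h with
  | nil => exact zero_le_one
  | cons s h ih =>
    refine mul_nonneg ih (mul_nonneg ?_ (σ.act_nonneg _ _ _))
    cases h with
    | nil => exact hα.1 _
    | cons s' t => exact M.p_nonneg _ _ _

lemma enabled_of_weight_ne_zero (M : MDP V A) (σ : M.Strategy) {α : V → ℝ} {s : V × A}
    {h : List (V × A)} (hw : M.weight σ α (s :: h) ≠ 0) : s.2 ∈ M.enabled s.1 :=
  σ.enabled_of_act_ne_zero (right_ne_zero_of_mul (right_ne_zero_of_mul hw))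

lemma isDist_nextDist (M : MDP V A) (σ : M.Strategy) {α : V → ℝ} (hα : IsDist α)
    {h : List (V × A)} (hw : M.weight σ α h ≠ 0) : IsDist (M.nextDist α h) := by
  cases h with
  | nil => exact hα
  | cons s t => exact ⟨M.p_nonneg _ _, M.p_sum _ _ (M.enabled_of_weight_ne_zero σ hw)⟩

section Run

variable [Nonempty V] [Nonempty A]

/-- The first `n` (state, action) pairs of the run, most recent first. -/
noncomputable def trace (M : MDP V A) (σ : M.Strategy) (α : V → ℝ) (x : ℝ) :
    ℕ → List (V × A)
  | 0 => []
  | n + 1 => (M.run σ α x n).2 :: (M.run σ α x n).1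

lemma run_eq (M : MDP V A) (σ : M.Strategy) (α : V → ℝ) (x : ℝ) (n : ℕ) :
    M.run σ α x n = (M.trace σ α x n,
      (sample (M.nextDist α (M.trace σ α x n)) (unif (2 * n) x),
        sample (σ.act (M.trace σ α x n)
          (sample (M.nextDist α (M.trace σ α x n)) (unif (2 * n) x))) (unif (2 * n + 1) x))) := by
  cases n <;> rfl

lemma trace_succ (M : MDP V A) (σ : M.Strategy) (α : V → ℝ) (x : ℝ) (n : ℕ) :
    M.trace σ α x (n + 1) = (M.run σ α x n).2 :: M.trace σ α x n := by
  rw [trace]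
  congr 1
  rw [run_eq]

lemma trace_succ_eq_iff (M : MDP V A) (σ : M.Strategy) (α : V → ℝ) (x : ℝ) (n : ℕ) (s : V × A)
    (h : List (V × A)) :
    M.trace σ α x (n + 1) = s :: h ↔ M.trace σ α x n = h ∧
      sample (M.nextDist α h) (unif (2 * n) x) = s.1 ∧
      sample (σ.act h s.1) (unif (2 * n + 1) x) = s.2 := by
  obtain ⟨v, a⟩ := s
  rw [trace_succ, run_eq, List.cons.injEq, Prod.mk.injEq]
  constructor
  · rintro ⟨⟨h1, h2⟩, rfl⟩
    rw [h1] at h2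
    exact ⟨rfl, h1, h2⟩
  · rintro ⟨rfl, h1, h2⟩
    rw [h1]
    exact ⟨⟨rfl, h2⟩, rfl⟩

lemma length_trace (M : MDP V A) (σ : M.Strategy) (α : V → ℝ) (x : ℝ) (n : ℕ) :
    (M.trace σ α x n).length = n := by
  induction n with
  | zero => rfl
  | succ n ih => rw [trace_succ, List.length_cons, ih]

lemma exists_mem_trace_iff (M : MDP V A) (σ : M.Strategy) (α : V → ℝ) (x : ℝ) (n : ℕ)
    (F : Set V) :
    (∃ s ∈ M.trace σ α x n, s.1 ∈ F) ↔ ∃ m < n, M.stateAt σ α x m ∈ F := by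
  induction n with
  | zero => simp [trace]
  | succ n ih =>
    rw [trace_succ]
    simp only [List.mem_cons, ih, Nat.lt_succ_iff_lt_or_eq, or_and_right,
      exists_or, exists_eq_left]
    exact or_comm

lemma exists_trace_eq_iff_digitSample (M : MDP V A) (σ : M.Strategy) {α : V → ℝ}
    (hα : IsDist α) (h : List (V × A)) :
    ∃ B : ℕ → Set ℝ, (∀ j, MeasurableSet (B j)) ∧
      (∀ x, 0 ≤ x → (M.trace σ α x h.length = h ↔
        ∀ j < 2 * h.length, digitSample j x ∈ B j)) ∧
      ∏ j ∈ Finset.range (2 * h.length), unitMeasure.real (B j) = M.weight σ α h := by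
  induction h with
  | nil => exact ⟨fun _ => Set.univ, fun _ => .univ, by simp [trace], by simp [weight]⟩
  | cons s h ih =>
    obtain ⟨B, hBm, hB, hBw⟩ := ih
    set n := h.length with hn
    have hlen : 2 * (s :: h).length = 2 * n + 1 + 1 := by rw [List.length_cons]; ring
    set B' : ℕ → Set ℝ := fun j =>
      if j < 2 * n then B j
      else if j = 2 * n then {u | sample (M.nextDist α h) u = s.1}
      else {u | sample (σ.act h s.1) u = s.2} with hB'
    have e0 : ∀ j < 2 * n, B' j = B j := fun j hj => if_pos hj
    have e1 : B' (2 * n) = {u | sample (M.nextDist α h) u = s.1} := by simp [hB']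
    have e2 : B' (2 * n + 1) = {u | sample (σ.act h s.1) u = s.2} := by simp [hB']
    refine ⟨B', fun j => ?_, fun x hx => ?_, ?_⟩
    · simp only [hB']
      split_ifs
      exacts [hBm j, measurableSet_sample_s10 _ _, measurableSet_sample_s10 _ _]
    · rw [hlen, List.length_cons, trace_succ_eq_iff, hB x hx, unif_eq_digitSample hx,
        unif_eq_digitSample hx, Nat.forall_lt_succ_right, Nat.forall_lt_succ_right, e1, e2,
        and_assoc]
      refine and_congr_left' (forall₂_congr fun j hj => ?_)
      rw [e0 j hj]
    · rw [hlen, Finset.prod_range_succ, Finset.prod_range_succ, e1, e2,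
        unitMeasure_sample (σ.isDist h s.1), mul_assoc, weight,
        Finset.prod_congr rfl fun j hj => by rw [e0 j (Finset.mem_range.1 hj)], hBw]
      by_cases hw : M.weight σ α h = 0
      · rw [hw, zero_mul, zero_mul]
      · rw [unitMeasure_sample (M.isDist_nextDist σ hα hw)]

lemma unitMeasure_trace_eq (M : MDP V A) (σ : M.Strategy) {α : V → ℝ}
    (hα : IsDist α) (h : List (V × A)) :
    NullMeasurableSet {x | M.trace σ α x h.length = h} unitMeasure ∧
      unitMeasure.real {x | M.trace σ α x h.length = h} = M.weight σ α h := by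
  obtain ⟨B, hBm, hB, hBw⟩ := M.exists_trace_eq_iff_digitSample σ hα h
  have hae : {x | ∀ j < 2 * h.length, digitSample j x ∈ B j} =ᵐ[unitMeasure]
      {x | M.trace σ α x h.length = h} := by
    refine (ae_restrict_iff' measurableSet_Ico).2 (Filter.Eventually.of_forall fun x hx => ?_)
    exact propext (hB x hx.1).symm
  have hmeas : MeasurableSet {x | ∀ j < 2 * h.length, digitSample j x ∈ B j} := by
    have : {x | ∀ j < 2 * h.length, digitSample j x ∈ B j} =
        ⋂ j, ⋂ (_ : j < 2 * h.length), digitSample j ⁻¹' B j := by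
      ext x; simp
    rw [this]
    exact MeasurableSet.iInter fun j => MeasurableSet.iInter fun _ =>
      measurable_digitSample j (hBm j)
  refine ⟨hmeas.nullMeasurableSet.congr hae, ?_⟩
  rw [← hBw, ← measureReal_congr hae, measureReal_def, unitMeasure_digitSample_lt _ hBm,
    ENNReal.toReal_prod]
  rfl

end Run

/-- The finite set of histories of length `n`. -/
def histories (V A : Type) [Fintype V] [Fintype A] : ℕ → Finset (List (V × A))
  | 0 => {[]}
  | n + 1 => (histories V A n ×ˢ (Finset.univ : Finset (V × A))).map
      ⟨fun q => q.2 :: q.1, fun q r hqr => by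
        obtain ⟨h1, h2⟩ := List.cons.inj hqr
        exact Prod.ext h2 h1⟩

lemma mem_histories {n : ℕ} {h : List (V × A)} : h ∈ histories V A n ↔ h.length = n := by
  induction n generalizing h with
  | zero => simp [histories]
  | succ n ih =>
    rw [histories, Finset.mem_map]
    constructor
    · rintro ⟨q, hq, rfl⟩
      exact congrArg (· + 1) (ih.1 (Finset.mem_product.1 hq).1)
    · intro hl
      obtain ⟨s, t, rfl⟩ := List.exists_cons_of_length_eq_add_one hl
      exact ⟨(t, s), Finset.mem_product.2 ⟨ih.2 (Nat.succ.inj hl), Finset.mem_univ _⟩, rfl⟩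

lemma sum_histories_succ (n : ℕ) (φ : List (V × A) → ℝ) :
    ∑ h ∈ histories V A (n + 1), φ h = ∑ h ∈ histories V A n, ∑ s, φ (s :: h) := by
  rw [histories, Finset.sum_map, Finset.sum_product]
  rfl

/-- The expected value of `f` at the state visited at time `n`. -/
def expect (M : MDP V A) (σ : M.Strategy) (α : V → ℝ) (n : ℕ) (f : V → ℝ) : ℝ :=
  ∑ h ∈ histories V A n, ∑ s, M.weight σ α (s :: h) * f s.1

lemma Absorbing.p_eq {M : MDP V A} {v : V} (hv : M.Absorbing v) {a : A} (ha : a ∈ M.enabled v)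
    {v' : V} (hne : v' ≠ v) : M.p v a v' = 0 := by
  classical
  obtain ⟨b, hb, hp⟩ := hv
  rw [hb, Finset.mem_singleton] at ha
  subst ha
  have hs := M.p_sum v a (by rw [hb]; exact Finset.mem_singleton_self a)
  rw [← Finset.add_sum_erase _ _ (Finset.mem_univ v), hp] at hs
  exact (Finset.sum_eq_zero_iff_of_nonneg fun i _ => M.p_nonneg v a i).1 (by linarith) v'
    (by simpa using hne)

lemma head_mem_of_weight_ne_zero (M : MDP V A) (σ : M.Strategy) (α : V → ℝ) {F : Set V}
    (hF : ∀ v ∈ F, M.Absorbing v) {s : V × A} {h : List (V × A)}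
    (hw : M.weight σ α (s :: h) ≠ 0) (hs : ∃ r ∈ s :: h, r.1 ∈ F) : s.1 ∈ F := by
  induction h generalizing s with
  | nil => simpa using hs
  | cons s' t ih =>
    rw [List.exists_mem_cons_iff] at hs
    refine hs.elim id fun hs => ?_
    have hw' := left_ne_zero_of_mul hw
    have h' := ih hw' hs
    by_contra hne
    refine left_ne_zero_of_mul (right_ne_zero_of_mul hw)
      ((hF _ h').p_eq (M.enabled_of_weight_ne_zero σ hw') fun he => hne ?_)
    rwa [he]

lemma tendsto_expect_PrReach [Nonempty V] [Nonempty A] [DecidableEq V] (M : MDP V A)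
    (σ : M.Strategy) {α : V → ℝ} (hα : IsDist α) {F : Finset V}
    (hF : ∀ v ∈ F, M.Absorbing v) :
    Filter.Tendsto (fun n => M.expect σ α n fun v => if v ∈ F then 1 else 0) Filter.atTop
      (nhds (M.PrReach σ α (F : Set V))) := by
  classical
  have hPr : M.PrReach σ α (F : Set V) =
      unitMeasure.real (⋃ n, {x | ∃ s ∈ M.trace σ α x (n + 1), s.1 ∈ (F : Set V)}) := by
    have hU : (⋃ n, {x | ∃ s ∈ M.trace σ α x (n + 1), s.1 ∈ (F : Set V)}) =
        {x | ∃ n, M.stateAt σ α x n ∈ (F : Set V)} := by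
      ext x
      simp only [Set.mem_iUnion, Set.mem_ofPred_eq, exists_mem_trace_iff]
      exact ⟨fun ⟨_, m, _, hm⟩ => ⟨m, hm⟩, fun ⟨m, hm⟩ => ⟨m, m, m.lt_succ_self, hm⟩⟩
    rw [hU, PrReach, PrEvent, measureReal_def, unitMeasure,
      Measure.restrict_apply' measurableSet_Ico]
    congr 1
    rw [Set.inter_comm]
    exact measure_congr (Ico_ae_eq_Icc.symm.inter (ae_eq_refl _))
  have hmono : Monotone fun n => {x | ∃ s ∈ M.trace σ α x (n + 1), s.1 ∈ (F : Set V)} := by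
    refine monotone_nat_of_le_succ fun n x ⟨s, hs, hsF⟩ => ⟨s, ?_, hsF⟩
    rw [trace_succ]
    exact List.mem_cons_of_mem _ hs
  have hval : ∀ n, M.expect σ α n (fun v => if v ∈ F then 1 else 0) =
      unitMeasure.real {x | ∃ s ∈ M.trace σ α x (n + 1), s.1 ∈ (F : Set V)} := by
    intro n
    have e : {x | ∃ s ∈ M.trace σ α x (n + 1), s.1 ∈ (F : Set V)} =
        ⋃ h ∈ (histories V A (n + 1)).filter fun h => ∃ s ∈ h, s.1 ∈ (F : Set V),
          {x | M.trace σ α x (n + 1) = h} := by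
      ext x
      simp only [Set.mem_ofPred_eq, Set.mem_iUnion, Finset.mem_filter, mem_histories]
      exact ⟨fun hx => ⟨_, ⟨length_trace .., hx⟩, rfl⟩, fun ⟨h, ⟨_, hx⟩, he⟩ => he ▸ hx⟩
    have hh : ∀ h ∈ (histories V A (n + 1)).filter fun h => ∃ s ∈ h, s.1 ∈ (F : Set V),
        NullMeasurableSet {x | M.trace σ α x (n + 1) = h} unitMeasure ∧
          unitMeasure.real {x | M.trace σ α x (n + 1) = h} = M.weight σ α h := by
      intro h hm
      have := M.unitMeasure_trace_eq σ hα h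
      rwa [mem_histories.1 (Finset.mem_filter.1 hm).1] at this
    rw [e, measureReal_biUnion_finset₀, Finset.sum_congr rfl fun h hm => (hh h hm).2,
      Finset.sum_filter, sum_histories_succ, expect]
    · refine Finset.sum_congr rfl fun h _ => Finset.sum_congr rfl fun s _ => ?_
      by_cases hw : M.weight σ α (s :: h) = 0
      · simp [hw]
      · have : s.1 ∈ F ↔ ∃ r ∈ s :: h, r.1 ∈ (F : Set V) :=
          ⟨fun hs => ⟨s, List.mem_cons_self, hs⟩,
            M.head_mem_of_weight_ne_zero σ α (F := (F : Set V)) hF hw⟩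
        simp only [this, mul_ite, mul_one, mul_zero]
    · intro h _ h' _ hne
      refine (Set.disjoint_left.2 fun x hx hx' => hne ?_).aedisjoint
      exact Eq.trans (Eq.symm hx) hx'
    · exact fun h hm => (hh h hm).1
  rw [hPr]
  simp only [hval]
  exact (ENNReal.tendsto_toReal (measure_ne_top _ _)).comp (tendsto_measure_iUnion_atTop hmono)

end MDP

namespace MDP

variable {V A : Type} [Fintype V] [Fintype A]

section Mixture

/-- The product of the probabilities with which `σ` picks the actions along a history. -/
def Strategy.likelihood {M : MDP V A} (σ : M.Strategy) : List (V × A) → ℝ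
  | [] => 1
  | s :: h => σ.likelihood h * σ.act h s.1 s.2

/-- The probability of a history is the product of the likelihoods of its states and of its
actions. -/
lemma exists_weight_eq_mul_likelihood (M : MDP V A) (α : V → ℝ) (h : List (V × A)) :
    ∃ c : ℝ, ∀ σ : M.Strategy, M.weight σ α h = c * σ.likelihood h := by
  induction h with
  | nil => exact ⟨1, fun σ => by simp [weight, Strategy.likelihood]⟩
  | cons s h ih =>
    obtain ⟨c, hc⟩ := ih
    refine ⟨c * M.nextDist α h s.1, fun σ => ?_⟩
    rw [weight, Strategy.likelihood, hc]
    ring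

lemma Strategy.likelihood_nonneg {M : MDP V A} (σ : M.Strategy) (h : List (V × A)) :
    0 ≤ σ.likelihood h := by
  induction h with
  | nil => exact zero_le_one
  | cons s h ih => exact mul_nonneg ih (σ.act_nonneg _ _ _)

/-- The behavioural strategy equivalent to playing `σ` with probability `a` and `τ` with
probability `b`. -/
noncomputable def Strategy.mix {M : MDP V A} (σ τ : M.Strategy) {a b : ℝ}
    (ha : 0 ≤ a) (hb : 0 ≤ b) : M.Strategy where
  act h v c :=
    if a * σ.likelihood h + b * τ.likelihood h = 0 then σ.act h v c
    else (a * σ.likelihood h * σ.act h v c + b * τ.likelihood h * τ.act h v c) /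
      (a * σ.likelihood h + b * τ.likelihood h)
  act_nonneg h v c := by
    have h1 := mul_nonneg ha (σ.likelihood_nonneg h)
    have h2 := mul_nonneg hb (τ.likelihood_nonneg h)
    split_ifs
    · exact σ.act_nonneg _ _ _
    · exact div_nonneg (add_nonneg (mul_nonneg h1 (σ.act_nonneg _ _ _))
        (mul_nonneg h2 (τ.act_nonneg _ _ _))) (add_nonneg h1 h2)
  act_support h v c hc := by simp [σ.act_support h v c hc, τ.act_support h v c hc]
  act_sum h v := by
    split_ifs with h0
    · exact σ.act_sum _ _
    · rw [← Finset.sum_div, Finset.sum_add_distrib, ← Finset.mul_sum, ← Finset.mul_sum,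
        σ.act_sum, τ.act_sum, mul_one, mul_one, div_self h0]

lemma Strategy.likelihood_mix {M : MDP V A} (σ τ : M.Strategy) {a b : ℝ}
    (ha : 0 ≤ a) (hb : 0 ≤ b) (hab : a + b = 1) (h : List (V × A)) :
    (σ.mix τ ha hb).likelihood h = a * σ.likelihood h + b * τ.likelihood h := by
  induction h with
  | nil => simp [likelihood, hab]
  | cons s h ih =>
    have h1 := mul_nonneg ha (σ.likelihood_nonneg h)
    have h2 := mul_nonneg hb (τ.likelihood_nonneg h)
    rw [likelihood, ih, likelihood, likelihood, ← mul_assoc, ← mul_assoc]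
    by_cases h0 : a * σ.likelihood h + b * τ.likelihood h = 0
    · have h3 : a * σ.likelihood h = 0 := by linarith
      have h4 : b * τ.likelihood h = 0 := by linarith
      rw [h0, h3, h4]
      ring
    · simp only [mix, if_neg h0]
      rw [mul_div_cancel₀ _ h0]

lemma expect_mix (M : MDP V A) (σ τ : M.Strategy) (α : V → ℝ) {a b : ℝ}
    (ha : 0 ≤ a) (hb : 0 ≤ b) (hab : a + b = 1) (n : ℕ) (f : V → ℝ) :
    M.expect (σ.mix τ ha hb) α n f = a * M.expect σ α n f + b * M.expect τ α n f := by
  have hw : ∀ h, M.weight (σ.mix τ ha hb) α h = a * M.weight σ α h + b * M.weight τ α h := by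
    intro h
    obtain ⟨c, hc⟩ := M.exists_weight_eq_mul_likelihood α h
    rw [hc, hc, hc, σ.likelihood_mix τ ha hb hab]
    ring
  simp only [expect, hw, add_mul, mul_assoc, Finset.sum_add_distrib, Finset.mul_sum]

variable [Nonempty V] [Nonempty A] [DecidableEq V]

lemma convex_achSet (M : MDP V A) {α : V → ℝ} (hα : IsDist α) {k : ℕ}
    {Fi : Fin k → Finset V} (hF : ∀ i, ∀ v ∈ Fi i, M.Absorbing v) :
    Convex ℝ (M.achSet α Fi) := by
  rintro x ⟨hx, σ, hσ⟩ y ⟨hy, τ, hτ⟩ a b ha hb hab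
  refine ⟨fun i => add_nonneg (mul_nonneg ha (hx i)) (mul_nonneg hb (hy i)),
    σ.mix τ ha hb, fun i => ?_⟩
  have h := M.tendsto_expect_PrReach (σ.mix τ ha hb) hα (hF i)
  simp only [M.expect_mix σ τ α ha hb hab] at h
  rw [tendsto_nhds_unique h (((M.tendsto_expect_PrReach σ hα (hF i)).const_mul a).add
    ((M.tendsto_expect_PrReach τ hα (hF i)).const_mul b))]
  exact add_le_add (mul_le_mul_of_nonneg_left (hσ i) ha) (mul_le_mul_of_nonneg_left (hτ i) hb)

end Mixture

section Optimality

lemma sum_weight_cons (M : MDP V A) (σ : M.Strategy) (α : V → ℝ) (h : List (V × A))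
    (f : V → ℝ) :
    ∑ s, M.weight σ α (s :: h) * f s.1 = M.weight σ α h * ∑ v, M.nextDist α h v * f v := by
  rw [Fintype.sum_prod_type, Finset.mul_sum]
  refine Finset.sum_congr rfl fun v _ => ?_
  simp only [weight]
  rw [← mul_one (M.weight σ α h * _), ← σ.act_sum h v, Finset.mul_sum]
  exact Finset.sum_congr rfl fun a _ => by ring

lemma expect_zero (M : MDP V A) (σ : M.Strategy) (α : V → ℝ) (f : V → ℝ) :
    M.expect σ α 0 f = ∑ v, α v * f v := by
  rw [expect, histories, Finset.sum_singleton, M.sum_weight_cons]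
  simp [weight, nextDist]

lemma expect_succ (M : MDP V A) (σ : M.Strategy) (α : V → ℝ) (n : ℕ)
    (f : V → ℝ) :
    M.expect σ α (n + 1) f =
      ∑ h ∈ histories V A n, ∑ s, M.weight σ α (s :: h) * ∑ v, M.p s.1 s.2 v * f v := by
  rw [expect, sum_histories_succ]
  exact Finset.sum_congr rfl fun h _ => Finset.sum_congr rfl fun s _ =>
    M.sum_weight_cons σ α (s :: h) f

lemma expect_one (M : MDP V A) (σ : M.Strategy) {α : V → ℝ} (hα : IsDist α) (n : ℕ) :
    M.expect σ α n (fun _ => 1) = 1 := by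
  induction n with
  | zero => simp [M.expect_zero, hα.2]
  | succ n ih =>
    refine Eq.trans ?_ ih
    rw [M.expect_succ, expect]
    refine Finset.sum_congr rfl fun h _ => Finset.sum_congr rfl fun s _ => ?_
    by_cases hw : M.weight σ α (s :: h) = 0
    · simp [hw]
    · simp [M.p_sum s.1 s.2 (M.enabled_of_weight_ne_zero σ hw)]

lemma expect_mono (M : MDP V A) (σ : M.Strategy) {α : V → ℝ} (hα : IsDist α) (n : ℕ)
    {f g : V → ℝ} (hfg : f ≤ g) : M.expect σ α n f ≤ M.expect σ α n g :=
  Finset.sum_le_sum fun _ _ => Finset.sum_le_sum fun s _ =>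
    mul_le_mul_of_nonneg_left (hfg s.1) (M.weight_nonneg σ hα _)

lemma expect_nonneg (M : MDP V A) (σ : M.Strategy) {α : V → ℝ} (hα : IsDist α) (n : ℕ)
    {f : V → ℝ} (hf : 0 ≤ f) : 0 ≤ M.expect σ α n f :=
  Finset.sum_nonneg fun _ _ => Finset.sum_nonneg fun s _ =>
    mul_nonneg (M.weight_nonneg σ hα _) (hf s.1)

lemma expect_le_norm (M : MDP V A) (σ : M.Strategy) {α : V → ℝ} (hα : IsDist α) (n : ℕ)
    (f : V → ℝ) : |M.expect σ α n f| ≤ ‖f‖ := by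
  have hc : ∀ c : ℝ, M.expect σ α n (fun _ => c) = c := by
    intro c
    have := M.expect_one σ hα n
    simp only [expect, mul_one] at this
    simp only [expect, ← Finset.sum_mul, this, one_mul]
  rw [abs_le]
  constructor
  · rw [← hc (-‖f‖)]
    exact M.expect_mono σ hα n fun v => (abs_le.1 (norm_le_pi_norm f v)).1
  · conv_rhs => rw [← hc ‖f‖]
    exact M.expect_mono σ hα n fun v => (abs_le.1 (norm_le_pi_norm f v)).2

/-- The discounted value of playing action `a` at `v` when the reward is `(1 - β) g` and the
continuation value is `J`. -/
def qValue (M : MDP V A) (β : ℝ) (g J : V → ℝ) (v : V) (a : A) : ℝ :=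
  (1 - β) * g v + β * ∑ v', M.p v a v' * J v'

lemma sum_weight_qValue (M : MDP V A) (σ : M.Strategy) (α : V → ℝ) (n : ℕ)
    (β : ℝ) (g J : V → ℝ) :
    ∑ h ∈ histories V A n, ∑ s, M.weight σ α (s :: h) * M.qValue β g J s.1 s.2 =
      (1 - β) * M.expect σ α n g + β * M.expect σ α (n + 1) J := by
  rw [M.expect_succ, expect, Finset.mul_sum, Finset.mul_sum, ← Finset.sum_add_distrib]
  refine Finset.sum_congr rfl fun h _ => ?_
  rw [Finset.mul_sum, Finset.mul_sum, ← Finset.sum_add_distrib]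
  exact Finset.sum_congr rfl fun s _ => by rw [qValue]; ring

/-- The Bellman operator of the `β`-discounted problem. -/
noncomputable def bellman (M : MDP V A) (β : ℝ) (g J : V → ℝ) (v : V) : ℝ :=
  (M.enabled v).sup' (M.enabled_nonempty v) (M.qValue β g J v)

lemma qValue_le_add (M : MDP V A) {β : ℝ} (hβ : 0 ≤ β) (g J J' : V → ℝ) {v : V} {a : A}
    (ha : a ∈ M.enabled v) : M.qValue β g J v a ≤ M.qValue β g J' v a + β * dist J J' := by
  have : ∑ v', M.p v a v' * J v' ≤ ∑ v', M.p v a v' * J' v' + dist J J' := by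
    rw [← one_mul (dist J J'), ← M.p_sum v a ha, Finset.sum_mul, ← Finset.sum_add_distrib]
    refine Finset.sum_le_sum fun v' _ => ?_
    rw [← mul_add]
    refine mul_le_mul_of_nonneg_left ?_ (M.p_nonneg _ _ _)
    have := (le_abs_self _).trans ((Real.dist_eq _ _).symm.le.trans (dist_le_pi_dist J J' v'))
    linarith
  have := mul_le_mul_of_nonneg_left this hβ
  unfold qValue
  linarith

lemma bellman_le_add (M : MDP V A) {β : ℝ} (hβ : 0 ≤ β) (g J J' : V → ℝ) (v : V) :
    M.bellman β g J v ≤ M.bellman β g J' v + β * dist J J' :=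
  Finset.sup'_le _ _ fun _ ha => (M.qValue_le_add hβ g J J' ha).trans
    (by gcongr; exact Finset.le_sup' (M.qValue β g J' v) ha)

lemma exists_bellman_fixed (M : MDP V A) {β : ℝ} (hβ : 0 ≤ β) (hβ1 : β < 1) (g : V → ℝ) :
    ∃ J, M.bellman β g J = J := by
  have hc : ContractingWith ⟨β, hβ⟩ (M.bellman β g) := by
    refine ⟨hβ1, LipschitzWith.of_dist_le_mul fun J J' => ?_⟩
    refine (dist_pi_le_iff (mul_nonneg hβ dist_nonneg)).2 fun v => ?_
    rw [Real.dist_eq, abs_le]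
    have h1 := M.bellman_le_add hβ g J J' v
    have h2 := M.bellman_le_add hβ g J' J v
    rw [dist_comm J' J] at h2
    constructor
    · change -(β * dist J J') ≤ _
      linarith
    · change _ ≤ β * dist J J'
      linarith
  exact ⟨_, hc.fixedPoint_isFixedPt⟩

/-- The pure memoryless strategy that always plays `f v` at `v`. -/
noncomputable def ofSelector (M : MDP V A) (f : (v : V) → M.enabled v) : M.Strategy := by
  classical
  exact
  { act := fun _ v a => if a = f v then 1 else 0
    act_nonneg := fun _ v a => by split_ifs <;> norm_num
    act_support := fun _ v a ha => if_neg fun h => ha (by rw [h]; exact (f v).2)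
    act_sum := fun _ v => by simp }

lemma memoryless_ofSelector (M : MDP V A) (f : (v : V) → M.enabled v) :
    (M.ofSelector f).Memoryless :=
  fun _ _ _ => rfl

lemma pure_ofSelector (M : MDP V A) (f : (v : V) → M.enabled v) : (M.ofSelector f).Pure :=
  fun _ v => ⟨f v, if_pos rfl⟩

lemma discounted_sum_add_le (M : MDP V A) (σ : M.Strategy) {α : V → ℝ} (hα : IsDist α)
    {β : ℝ} (hβ : 0 ≤ β) {g J : V → ℝ}
    (hJ : ∀ v, ∀ a ∈ M.enabled v, M.qValue β g J v a ≤ J v) (n : ℕ) :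
    (∑ m ∈ Finset.range n, β ^ m * ((1 - β) * M.expect σ α m g)) +
      β ^ n * M.expect σ α n J ≤ ∑ v, α v * J v := by
  induction n with
  | zero => simp [M.expect_zero]
  | succ n ih =>
    refine le_trans ?_ ih
    have : (1 - β) * M.expect σ α n g + β * M.expect σ α (n + 1) J ≤ M.expect σ α n J := by
      rw [← M.sum_weight_qValue]
      refine Finset.sum_le_sum fun h _ => Finset.sum_le_sum fun s _ => ?_
      by_cases hw : M.weight σ α (s :: h) = 0
      · simp [hw]
      · exact mul_le_mul_of_nonneg_left (hJ _ _ (M.enabled_of_weight_ne_zero σ hw))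
          (M.weight_nonneg σ hα _)
    have := mul_le_mul_of_nonneg_left this (pow_nonneg hβ n)
    rw [Finset.sum_range_succ, pow_succ]
    linarith

lemma discounted_sum_add_eq (M : MDP V A) (α : V → ℝ) {β : ℝ} {g J : V → ℝ}
    (f : (v : V) → M.enabled v) (hJ : ∀ v, M.qValue β g J v (f v) = J v) (n : ℕ) :
    (∑ m ∈ Finset.range n, β ^ m * ((1 - β) * M.expect (M.ofSelector f) α m g)) +
      β ^ n * M.expect (M.ofSelector f) α n J = ∑ v, α v * J v := by
  induction n with
  | zero => simp [M.expect_zero]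
  | succ n ih =>
    refine Eq.trans ?_ ih
    have : (1 - β) * M.expect (M.ofSelector f) α n g +
        β * M.expect (M.ofSelector f) α (n + 1) J = M.expect (M.ofSelector f) α n J := by
      rw [← M.sum_weight_qValue]
      refine Finset.sum_congr rfl fun h _ => Finset.sum_congr rfl fun s _ => ?_
      by_cases hs : s.2 = f s.1
      · rw [hs, hJ]
      · have : (M.ofSelector f).act h s.1 s.2 = 0 := if_neg hs
        simp [weight, this]
    rw [Finset.sum_range_succ, pow_succ, ← this]
    ring

lemma expect_monotone_of_absorbing (M : MDP V A) (σ : M.Strategy) {α : V → ℝ} (hα : IsDist α)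
    {g : V → ℝ} (hg : 0 ≤ g) (habs : ∀ v, g v ≠ 0 → M.Absorbing v) :
    Monotone fun n => M.expect σ α n g := by
  refine monotone_nat_of_le_succ fun n => ?_
  rw [M.expect_succ]
  refine Finset.sum_le_sum fun h _ => Finset.sum_le_sum fun s _ => ?_
  by_cases hw : M.weight σ α (s :: h) = 0
  · simp [hw]
  refine mul_le_mul_of_nonneg_left ?_ (M.weight_nonneg σ hα _)
  by_cases h0 : g s.1 = 0
  · rw [h0]
    exact Finset.sum_nonneg fun v _ => mul_nonneg (M.p_nonneg _ _ _) (hg v)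
  · obtain ⟨a, ha, hp⟩ := habs _ h0
    have hs := M.enabled_of_weight_ne_zero σ hw
    rw [ha, Finset.mem_singleton] at hs
    calc g s.1 = M.p s.1 s.2 s.1 * g s.1 := by rw [hs, hp, one_mul]
      _ ≤ _ := Finset.single_le_sum (f := fun v => M.p s.1 s.2 v * g v)
        (fun v _ => mul_nonneg (M.p_nonneg _ _ _) (hg v)) (Finset.mem_univ _)

/-- If the expected rewards of all pure memoryless strategies are bounded by `c`, then so are
those of all strategies, provided that the reward is only collected in absorbing states. -/
lemma expect_le_of_forall_ofSelector (M : MDP V A) (σ : M.Strategy) {α : V → ℝ}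
    (hα : IsDist α) {g : V → ℝ} (hg : 0 ≤ g) (habs : ∀ v, g v ≠ 0 → M.Absorbing v) {c : ℝ}
    (hc : ∀ f n, M.expect (M.ofSelector f) α n g ≤ c) (N : ℕ) : M.expect σ α N g ≤ c := by
  have key : ∀ β : ℝ, 0 ≤ β → β < 1 → β ^ N * M.expect σ α N g ≤ c := by
    intro β hβ hβ1
    obtain ⟨J, hJ⟩ := M.exists_bellman_fixed hβ hβ1 g
    have hle : ∀ v, ∀ a ∈ M.enabled v, M.qValue β g J v a ≤ J v := fun v a ha =>
      (Finset.le_sup' (M.qValue β g J v) ha).trans (congrFun hJ v).le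
    have hex : ∀ v, ∃ a : M.enabled v, M.qValue β g J v a = J v := by
      intro v
      obtain ⟨a, ha, he⟩ := Finset.exists_mem_eq_sup' (M.enabled_nonempty v) (M.qValue β g J v)
      exact ⟨⟨a, ha⟩, he.symm.trans (congrFun hJ v)⟩
    choose f hf using hex
    have hgeom : ∀ a b : ℕ, a ≤ b →
        ∑ m ∈ Finset.Ico a b, β ^ m * (1 - β) = β ^ a - β ^ b := by
      intro a b hab
      rw [← Finset.sum_mul, geom_sum_Ico hβ1.ne hab, div_mul_eq_mul_div,
        div_eq_iff (sub_ne_zero.2 hβ1.ne)]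
      ring
    have hbound : ∀ K, N ≤ K →
        (β ^ N - β ^ K) * M.expect σ α N g - β ^ K * ‖J‖ ≤ (1 - β ^ K) * c + β ^ K * ‖J‖ := by
      intro K hK
      have hβK := pow_nonneg hβ K
      have h1 : (β ^ N - β ^ K) * M.expect σ α N g ≤
          ∑ m ∈ Finset.range K, β ^ m * ((1 - β) * M.expect σ α m g) := by
        rw [← hgeom N K hK, Finset.sum_mul, Finset.range_eq_Ico]
        refine (Finset.sum_le_sum fun m hm => ?_).trans (Finset.sum_le_sum_of_subset_of_nonneg
          (Finset.Ico_subset_Ico_left N.zero_le) fun m _ _ => ?_)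
        · rw [mul_assoc]
          have := M.expect_monotone_of_absorbing σ hα hg habs (Finset.mem_Ico.1 hm).1
          exact mul_le_mul_of_nonneg_left
            (mul_le_mul_of_nonneg_left this (by linarith)) (pow_nonneg hβ m)
        · exact mul_nonneg (pow_nonneg hβ m)
            (mul_nonneg (by linarith) (M.expect_nonneg σ hα m hg))
      have h2 : ∑ m ∈ Finset.range K, β ^ m * ((1 - β) * M.expect (M.ofSelector f) α m g) ≤
          (1 - β ^ K) * c := by
        have := hgeom 0 K K.zero_le
        rw [pow_zero] at this
        rw [← this, Finset.sum_mul, Finset.range_eq_Ico]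
        refine Finset.sum_le_sum fun m _ => ?_
        rw [mul_assoc]
        exact mul_le_mul_of_nonneg_left
          (mul_le_mul_of_nonneg_left (hc f m) (by linarith)) (pow_nonneg hβ m)
      have h3 := M.discounted_sum_add_le σ hα hβ hle K
      have h4 := M.discounted_sum_add_eq α f hf K
      have h5 := mul_le_mul_of_nonneg_left (abs_le.1 (M.expect_le_norm σ hα K J)).1 hβK
      have h6 := mul_le_mul_of_nonneg_left
        (abs_le.1 (M.expect_le_norm (M.ofSelector f) hα K J)).2 hβK
      linarith
    have hpow := tendsto_pow_atTop_nhds_zero_of_lt_one hβ hβ1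
    have hl : Filter.Tendsto
        (fun K : ℕ => (β ^ N - β ^ K) * M.expect σ α N g - β ^ K * ‖J‖) Filter.atTop
        (nhds ((β ^ N - 0) * M.expect σ α N g - 0 * ‖J‖)) :=
      ((tendsto_const_nhds.sub hpow).mul_const _).sub (hpow.mul_const _)
    have hr : Filter.Tendsto (fun K : ℕ => (1 - β ^ K) * c + β ^ K * ‖J‖) Filter.atTop
        (nhds ((1 - 0) * c + 0 * ‖J‖)) :=
      ((tendsto_const_nhds.sub hpow).mul_const _).add (hpow.mul_const _)
    have := le_of_tendsto_of_tendsto hl hr (Filter.eventually_atTop.2 ⟨N, hbound⟩)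
    simpa using this
  have hlim : Filter.Tendsto (fun β : ℝ => β ^ N * M.expect σ α N g)
      (nhdsWithin 1 (Set.Iio 1)) (nhds (1 ^ N * M.expect σ α N g)) :=
    ((continuous_pow N).mul continuous_const).continuousWithinAt
  rw [one_pow, one_mul] at hlim
  refine le_of_tendsto hlim ?_
  filter_upwards [Ioo_mem_nhdsLT zero_lt_one] with β hβ using key β hβ.1.le hβ.2

end Optimality

section Reachability

variable [Nonempty V] [Nonempty A]

/-- The vector of probabilities with which `σ` reaches the targets. -/
noncomputable def reachVec (M : MDP V A) (α : V → ℝ) {k : ℕ} (Fi : Fin k → Finset V)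
    (σ : M.Strategy) : Fin k → ℝ :=
  fun i => M.PrReach σ α (↑(Fi i) : Set V)

lemma reachVec_mem_achSet (M : MDP V A) (α : V → ℝ) {k : ℕ} (Fi : Fin k → Finset V)
    (σ : M.Strategy) : M.reachVec α Fi σ ∈ M.achSet α Fi :=
  ⟨fun _ => ENNReal.toReal_nonneg, σ, fun _ => le_rfl⟩

variable [DecidableEq V]

lemma sum_mul_reachVec_le (M : MDP V A) (σ : M.Strategy) {α : V → ℝ} (hα : IsDist α) {k : ℕ}
    {Fi : Fin k → Finset V} (hF : ∀ i, ∀ v ∈ Fi i, M.Absorbing v) {w : Fin k → ℝ} (hw : 0 ≤ w)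
    {c : ℝ} (hc : ∀ f, ∑ i, w i * M.reachVec α Fi (M.ofSelector f) i ≤ c) :
    ∑ i, w i * M.reachVec α Fi σ i ≤ c := by
  set g : V → ℝ := fun v => ∑ i, w i * if v ∈ Fi i then 1 else 0 with hg
  have hg0 : 0 ≤ g := fun v => Finset.sum_nonneg fun i _ =>
    mul_nonneg (hw i) (by split_ifs <;> norm_num)
  have habs : ∀ v, g v ≠ 0 → M.Absorbing v := by
    intro v hv
    obtain ⟨i, _, hi⟩ := Finset.exists_ne_zero_of_sum_ne_zero hv
    refine hF i v ?_
    by_contra h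
    simp [h] at hi
  have hexp : ∀ (τ : M.Strategy) n, M.expect τ α n g =
      ∑ i, w i * M.expect τ α n fun v => if v ∈ Fi i then 1 else 0 := by
    intro τ n
    simp only [expect, hg, Finset.mul_sum]
    rw [Finset.sum_comm]
    conv_rhs => rw [Finset.sum_comm]
    rw [Finset.sum_comm]
    refine Finset.sum_congr rfl fun h _ => ?_
    rw [Finset.sum_comm]
    exact Finset.sum_congr rfl fun i _ => Finset.sum_congr rfl fun s _ => by ring
  have hlim : ∀ τ : M.Strategy, Filter.Tendsto (fun n => M.expect τ α n g) Filter.atTop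
      (nhds (∑ i, w i * M.reachVec α Fi τ i)) := by
    intro τ
    simp only [hexp]
    exact tendsto_finsetSum _ fun i _ => (M.tendsto_expect_PrReach τ hα (hF i)).const_mul (w i)
  refine le_of_tendsto' (hlim σ) (M.expect_le_of_forall_ofSelector σ hα hg0 habs fun f n => ?_)
  exact ((M.expect_monotone_of_absorbing _ hα hg0 habs).ge_of_tendsto (hlim _) n).trans (hc f)

lemma exists_mem_convexHull_le (M : MDP V A) (σ : M.Strategy) {α : V → ℝ} (hα : IsDist α)
    {k : ℕ} {Fi : Fin k → Finset V} (hF : ∀ i, ∀ v ∈ Fi i, M.Absorbing v) :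
    ∃ y ∈ convexHull ℝ (Set.range fun f => M.reachVec α Fi (M.ofSelector f)),
      M.reachVec α Fi σ ≤ y := by
  classical
  set P := Set.range fun f => M.reachVec α Fi (M.ofSelector f)
  by_contra! hcon
  have hdisj : Disjoint (convexHull ℝ P) (Set.Ici (M.reachVec α Fi σ)) :=
    Set.disjoint_left.2 fun y hy hy' => hcon y hy hy'
  obtain ⟨φ, u, v, hφP, huv, hφσ⟩ := geometric_hahn_banach_compact_closed
    (convex_convexHull ℝ P) ((Set.finite_range _).isCompact_convexHull ℝ)
    (convex_Ici (𝕜 := ℝ) (M.reachVec α Fi σ)) isClosed_Ici hdisj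
  set w : Fin k → ℝ := fun i => φ (Pi.single i 1)
  have hφ : ∀ y, φ y = ∑ i, w i * y i := by
    intro y
    conv_lhs => rw [pi_eq_sum_univ' y]
    rw [map_sum]
    refine Finset.sum_congr rfl fun i _ => ?_
    rw [map_smul, smul_eq_mul, mul_comm]
  have hw0 : 0 ≤ w := by
    intro i
    by_contra! hneg
    change w i < 0 at hneg
    set x := M.reachVec α Fi σ
    have hvx : v < φ x := hφσ x Set.self_mem_Ici
    have ht : 0 ≤ (φ x - v) / (-w i) := div_nonneg (by linarith) (by linarith)
    have := hφσ (x + ((φ x - v) / (-w i)) • Pi.single i 1)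
      (Set.mem_Ici.2 (le_add_of_nonneg_right
        (smul_nonneg ht (Pi.single_nonneg.2 zero_le_one))))
    rw [map_add, map_smul, smul_eq_mul] at this
    change v < φ x + (φ x - v) / (-w i) * w i at this
    have e : (φ x - v) / (-w i) * w i = -(φ x - v) := by
      rw [div_neg, neg_mul, div_mul_cancel₀ _ hneg.ne]
    rw [e] at this
    linarith
  have h1 := M.sum_mul_reachVec_le σ hα hF hw0 (c := u) fun f => by
    rw [← hφ]
    exact (hφP _ (subset_convexHull ℝ P ⟨f, rfl⟩)).le
  have h2 := hφσ (M.reachVec α Fi σ) Set.self_mem_Ici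
  rw [hφ] at h2
  linarith

end Reachability

end MDP

open MDP in
/-- For a cleaned-up MDP with absorbing targets, every Pareto-optimal extreme point of
the achievable set `U` equals the value vector
`(Pr^σ_α(◇F_1), …, Pr^σ_α(◇F_k))` of some pure memoryless strategy `σ`. -/
theorem pareto_extreme_points_from_pure_memoryless
    {V A : Type} [Fintype V] [Fintype A] [Nonempty V] [Nonempty A] [DecidableEq V]
    (M : MDP V A) {k : ℕ} (Fi : Fin k → Finset V) (F : Finset V)
    (hF : F = Finset.univ.biUnion Fi)
    (habs : ∀ v ∈ F, M.Absorbing v)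
    (hclean : M.CleanedUp (↑F : Set V))
    (α : V → ℝ) (hα : IsDist α) (hsupp : ∀ v ∈ F, α v = 0) :
    ∀ x ∈ Set.extremePoints ℝ (M.achSet α Fi),
      (¬ ∃ x' ∈ M.achSet α Fi, x ≤ x' ∧ x ≠ x') →
      ∃ σ : M.Strategy, σ.Memoryless ∧ σ.Pure ∧
        x = fun i => M.PrReach σ α (↑(Fi i) : Set V) := by
  classical
  have habs' : ∀ i, ∀ v ∈ Fi i, M.Absorbing v := fun i v hv =>
    habs v (hF ▸ Finset.mem_biUnion.2 ⟨i, Finset.mem_univ i, hv⟩)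
  intro x hx hpar
  have hmax : ∀ y ∈ M.achSet α Fi, x ≤ y → x = y := fun y hy hxy =>
    by_contra fun hne => hpar ⟨y, hy, hxy, hne⟩
  obtain ⟨-, σ, hσ⟩ := hx.1
  obtain ⟨y, hy, hσy⟩ := M.exists_mem_convexHull_le σ hα habs'
  have hsub : convexHull ℝ (Set.range fun f => M.reachVec α Fi (M.ofSelector f)) ⊆
      M.achSet α Fi :=
    convexHull_min (Set.range_subset_iff.2 fun f => M.reachVec_mem_achSet α Fi _)
      (M.convex_achSet hα habs')
  obtain rfl := hmax y (hsub hy) (le_trans hσ hσy)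
  obtain ⟨f, hf⟩ := extremePoints_convexHull_subset
    (inter_extremePoints_subset_extremePoints_of_subset hsub ⟨hy, hx⟩)
  exact ⟨M.ofSelector f, M.memoryless_ofSelector f, M.pure_ofSelector f, hf.symm⟩
end
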